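/- Every smooth centrally symmetric lattice 3-polytope has a unimodular cover. -/

import Mathlib

open scoped Pointwise

noncomputable section

/-- The real point corresponding to an integer point of `ℤ³`. -/
def toR3 (v : Fin 3 → ℤ) : Fin 3 → ℝ := fun i => (v i : ℝ)

/-- A unimodular tetrahedron: the convex hull of lattice points `v0, v1, v2, v3`
such that `v1 - v0, v2 - v0, v3 - v0` form a `ℤ`-basis of `ℤ³`. -/
def IsUnimodularTet (S : Set (Fin 3 → ℝ)) : Prop :=
  ∃ v : Fin 4 → Fin 3 → ℤ,
    S = convexHull ℝ {toR3 (v 0), toR3 (v 1), toR3 (v 2), toR3 (v 3)} ∧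
    (Matrix.of ![v 1 - v 0, v 2 - v 0, v 3 - v 0]).det ∈ ({1, -1} : Set ℤ)

/-- A unimodular cover of `P`. -/
def HasUnimodularCover (P : Set (Fin 3 → ℝ)) : Prop :=
  ∃ 𝒞 : Set (Set (Fin 3 → ℝ)),
    (∀ S ∈ 𝒞, IsUnimodularTet S ∧ S ⊆ P) ∧ ⋃₀ 𝒞 = P

/-- A vertex of a polytope `P` is an extreme point of `P`. -/
def IsVertex (P : Set (Fin 3 → ℝ)) (v : Fin 3 → ℝ) : Prop :=
  v ∈ Set.extremePoints ℝ P

/-- `[v,w]` is an edge of the polytope `P`: a one-dimensional extreme face. -/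
def IsEdge (P : Set (Fin 3 → ℝ)) (v w : Fin 3 → ℝ) : Prop :=
  v ≠ w ∧ IsExtreme ℝ P (segment ℝ v w)

/-- A primitive lattice vector: the gcd of its coordinates is `1`. -/
def IsPrimitive3 (d : Fin 3 → ℤ) : Prop :=
  Int.gcd (d 0) (Int.gcd (d 1) (d 2)) = 1

/-- A lattice 3-polytope is smooth if it is simple (every vertex lies on exactly
3 edges) and at each vertex the primitive lattice vectors in the directions of
the three edges form a `ℤ`-basis of `ℤ³`. -/
def IsSmooth (P : Set (Fin 3 → ℝ)) : Prop :=
  ∀ v, IsVertex P v →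
    ∃ w : Fin 3 → Fin 3 → ℝ, Function.Injective w ∧
      {x | IsEdge P v x} = {w 0, w 1, w 2} ∧
      ∃ d : Fin 3 → Fin 3 → ℤ,
        (∀ i, IsPrimitive3 (d i) ∧ ∃ t : ℝ, 0 < t ∧ w i - v = t • toR3 (d i)) ∧
        (Matrix.of ![d 0, d 1, d 2]).det ∈ ({1, -1} : Set ℤ)

set_option linter.unusedSimpArgs false
set_option linter.unusedVariables false

def det3 {R : Type*} [CommRing R] (u v w : Fin 3 → R) : R :=
  u 0 * (v 1 * w 2 - v 2 * w 1) - u 1 * (v 0 * w 2 - v 2 * w 0) + u 2 * (v 0 * w 1 - v 1 * w 0)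

lemma det3_eq {R : Type*} [CommRing R] (u v w : Fin 3 → R) :
    (Matrix.of ![u, v, w]).det = det3 u v w := by
  rw [Matrix.det_fin_three]; simp [det3]; ring

lemma toR3_add (u v : Fin 3 → ℤ) : toR3 (u + v) = toR3 u + toR3 v := by
  ext i; simp [toR3]
lemma toR3_sub (u v : Fin 3 → ℤ) : toR3 (u - v) = toR3 u - toR3 v := by
  ext i; simp [toR3]
lemma toR3_smul (n : ℤ) (v : Fin 3 → ℤ) : toR3 (n • v) = (n : ℝ) • toR3 v := by
  ext i; simp [toR3]
lemma toR3_neg (v : Fin 3 → ℤ) : toR3 (-v) = - toR3 v := by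
  ext i; simp [toR3]
lemma toR3_inj {u v : Fin 3 → ℤ} (h : toR3 u = toR3 v) : u = v := by
  ext i; have := congrFun h i; simpa [toR3] using this
lemma det3_toR3 (u v w : Fin 3 → ℤ) : det3 (toR3 u) (toR3 v) (toR3 w) = ((det3 u v w : ℤ) : ℝ) := by
  simp [det3, toR3]

/-- determinant of a lattice tetrahedron -/
def tdet (v : Fin 4 → Fin 3 → ℤ) : ℤ := det3 (v 1 - v 0) (v 2 - v 0) (v 3 - v 0)

/-- `x` is in the convex hull of the four lattice points -/
def InTet (v : Fin 4 → Fin 3 → ℤ) (x : Fin 3 → ℝ) : Prop :=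
  ∃ ξ : Fin 4 → ℝ, (∀ i, 0 ≤ ξ i) ∧ ∑ i, ξ i = 1 ∧ x = ∑ i, ξ i • toR3 (v i)

def Cov (P : Set (Fin 3 → ℝ)) (x : Fin 3 → ℝ) : Prop :=
  ∃ v : Fin 4 → Fin 3 → ℤ, (∀ i, toR3 (v i) ∈ P) ∧ (tdet v = 1 ∨ tdet v = -1) ∧ InTet v x

lemma cover_of_cov {P : Set (Fin 3 → ℝ)} (hc : Convex ℝ P) (h : ∀ x ∈ P, Cov P x) :
    HasUnimodularCover P := by
  refine ⟨{S | IsUnimodularTet S ∧ S ⊆ P}, fun S hS => hS, ?_⟩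
  apply Set.Subset.antisymm
  · exact Set.sUnion_subset fun S hS => hS.2
  · intro x hx
    obtain ⟨v, hv, hd, ξ, h0, h1, hx⟩ := h x hx
    refine ⟨convexHull ℝ {toR3 (v 0), toR3 (v 1), toR3 (v 2), toR3 (v 3)}, ⟨⟨v, rfl, ?_⟩, ?_⟩, ?_⟩
    · rw [det3_eq]; exact hd
    · apply convexHull_min _ hc
      intro y hy
      simp only [Set.mem_insert_iff, Set.mem_singleton_iff] at hy
      rcases hy with rfl | rfl | rfl | rfl <;> apply hv
    · rw [hx]
      apply (convex_convexHull ℝ _).sum_mem (fun i _ => h0 i) h1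
      intro i _
      apply subset_convexHull
      fin_cases i <;> simp

lemma tetflip (v : Fin 4 → Fin 3 → ℤ) (q : Fin 3 → ℤ) (κ : Fin 4 → ℝ) (h1 : ∑ i, κ i = 1)
    (hq : toR3 q = ∑ i, κ i • toR3 (v i)) (x : Fin 3 → ℝ) (hx : InTet v x) :
    ∃ i, 0 < κ i ∧ (tdet (Function.update v i q) : ℝ) = κ i * tdet v ∧
      InTet (Function.update v i q) x := by
  obtain ⟨ξ, h0, hs, hx⟩ := hx
  have hne : (Finset.univ.filter fun i => 0 < κ i).Nonempty := by
    by_contra hcon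
    rw [Finset.not_nonempty_iff_eq_empty, Finset.filter_eq_empty_iff] at hcon
    have : ∑ i, κ i ≤ 0 := Finset.sum_nonpos fun i hi => not_lt.1 (hcon hi)
    linarith
  obtain ⟨i, hi, hmin⟩ := Finset.exists_min_image _ (fun i => ξ i / κ i) hne
  simp only [Finset.mem_filter, Finset.mem_univ, true_and] at hi hmin
  refine ⟨i, hi, ?_, ?_⟩
  · have hk : ∀ k, (q k : ℝ) = κ 0 * v 0 k + κ 1 * v 1 k + κ 2 * v 2 k + κ 3 * v 3 k := by
      intro k
      have := congrFun hq k
      simpa [toR3, Fin.sum_univ_four] using this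
    have h00 : κ 0 = 1 - κ 1 - κ 2 - κ 3 := by
      rw [Fin.sum_univ_four] at h1; linarith
    fin_cases i <;> simp [tdet, det3, Function.update] <;> rw [hk 0, hk 1, hk 2, h00] <;> ring
  · set τ := ξ i / κ i with hτ
    have hτ0 : 0 ≤ τ := div_nonneg (h0 i) hi.le
    have hge : ∀ j, 0 ≤ ξ j - τ * κ j := by
      intro j
      by_cases hj : 0 < κ j
      · have := hmin j hj
        rw [le_div_iff₀ hj] at this
        linarith
      · have := mul_nonneg hτ0 (neg_nonneg.2 (not_lt.1 hj))
        have := h0 j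
        linarith
    have hii : ξ i - τ * κ i = 0 := by rw [hτ]; field_simp; ring
    refine ⟨Function.update (fun j => ξ j - τ * κ j) i τ, ?_, ?_, ?_⟩
    · intro j
      by_cases hj : j = i
      · subst hj; simpa using hτ0
      · simpa [Function.update_of_ne hj] using hge j
    · rw [← Finset.add_sum_erase _ _ (Finset.mem_univ i)]
      have : ∑ j ∈ Finset.univ.erase i, Function.update (fun j => ξ j - τ * κ j) i τ j
          = ∑ j ∈ Finset.univ.erase i, (ξ j - τ * κ j) := by
        apply Finset.sum_congr rfl
        intro j hj
        rw [Function.update_of_ne (Finset.ne_of_mem_erase hj)]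
      rw [this]
      have h2 := Finset.add_sum_erase Finset.univ (fun j => ξ j - τ * κ j) (Finset.mem_univ i)
      simp only [hii, zero_add] at h2
      rw [h2, Finset.sum_sub_distrib, ← Finset.mul_sum, hs, h1]
      simp
    · rw [← Finset.add_sum_erase _ _ (Finset.mem_univ i)]
      have : ∑ j ∈ Finset.univ.erase i, Function.update (fun j => ξ j - τ * κ j) i τ j •
            toR3 (Function.update v i q j)
          = ∑ j ∈ Finset.univ.erase i, (ξ j - τ * κ j) • toR3 (v j) := by
        apply Finset.sum_congr rfl
        intro j hj
        rw [Function.update_of_ne (Finset.ne_of_mem_erase hj),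
          Function.update_of_ne (Finset.ne_of_mem_erase hj)]
      rw [this]
      have h2 := Finset.add_sum_erase Finset.univ (fun j => (ξ j - τ * κ j) • toR3 (v j))
        (Finset.mem_univ i)
      simp only [hii, zero_add, zero_smul] at h2
      rw [h2]
      simp only [sub_smul, Finset.sum_sub_distrib, mul_smul, ← Finset.smul_sum]
      rw [← hx, ← hq]; simp

/-- one flip decreases the volume -/
lemma flip_lt (v : Fin 4 → Fin 3 → ℤ) (hD : tdet v ≠ 0)
    (q : Fin 3 → ℤ) (κ : Fin 4 → ℝ) (h1 : ∑ i, κ i = 1) (hlt : ∀ i, κ i < 1)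
    (hq : toR3 q = ∑ i, κ i • toR3 (v i)) (x : Fin 3 → ℝ) (hx : InTet v x) :
    ∃ i, 0 < κ i ∧ tdet (Function.update v i q) ≠ 0 ∧
      (tdet (Function.update v i q)).natAbs < (tdet v).natAbs ∧
      InTet (Function.update v i q) x := by
  obtain ⟨i, hi, hd, hin⟩ := tetflip v q κ h1 hq x hx
  have hDr : (tdet v : ℝ) ≠ 0 := by exact_mod_cast hD
  refine ⟨i, hi, ?_, ?_, hin⟩
  · have : (tdet (Function.update v i q) : ℝ) ≠ 0 := by
      rw [hd]; exact mul_ne_zero hi.ne' hDr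
    exact_mod_cast this
  · zify
    have : |(tdet (Function.update v i q) : ℝ)| < |(tdet v : ℝ)| := by
      rw [hd, abs_mul, abs_of_pos hi]
      have := abs_pos.2 hDr
      nlinarith [hlt i]
    exact_mod_cast this

lemma exists_bary (v : Fin 4 → Fin 3 → ℤ) (hD : tdet v ≠ 0) (b : Fin 3 → ℝ) :
    ∃ μ : Fin 4 → ℝ, ∑ i, μ i = 1 ∧ b = ∑ i, μ i • toR3 (v i) := by
  have hDr : (tdet v : ℝ) ≠ 0 := by exact_mod_cast hD
  set A : Fin 3 → Fin 3 → ℝ := ![toR3 (v 1 - v 0), toR3 (v 2 - v 0), toR3 (v 3 - v 0)] with hA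
  set B := b - toR3 (v 0) with hB
  have hdet : det3 (A 0) (A 1) (A 2) = tdet v := det3_toR3 _ _ _
  set D := det3 (A 0) (A 1) (A 2) with hDd
  have hD0 : D ≠ 0 := by rw [hdet]; exact hDr
  set t1 := det3 B (A 1) (A 2) / D with ht1
  set t2 := det3 (A 0) B (A 2) / D with ht2
  set t3 := det3 (A 0) (A 1) B / D with ht3
  have key : B = t1 • A 0 + t2 • A 1 + t3 • A 2 := by
    have e1 : D * t1 = det3 B (A 1) (A 2) := by rw [ht1]; field_simp
    have e2 : D * t2 = det3 (A 0) B (A 2) := by rw [ht2]; field_simp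
    have e3 : D * t3 = det3 (A 0) (A 1) B := by rw [ht3]; field_simp
    clear_value t1 t2 t3
    ext k
    apply mul_left_cancel₀ hD0
    have : D * (t1 • A 0 + t2 • A 1 + t3 • A 2) k = (D * t1) * A 0 k + (D * t2) * A 1 k + (D * t3) * A 2 k := by
      simp; ring
    rw [this, e1, e2, e3, hDd]
    fin_cases k <;> simp [det3] <;> ring
  refine ⟨![1 - t1 - t2 - t3, t1, t2, t3], ?_, ?_⟩
  · simp [Fin.sum_univ_four]; ring
  · have hb : b = toR3 (v 0) + B := by rw [hB]; abel
    rw [hb, key]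
    ext k
    simp [Fin.sum_univ_four, hA, toR3_sub]
    ring

lemma exists_nonint (v : Fin 4 → Fin 3 → ℤ) (hD : tdet v ≠ 0) (h1 : ¬ (tdet v = 1 ∨ tdet v = -1)) :
    ∃ (m : Fin 3 → ℤ) (μ : Fin 4 → ℝ), ∑ i, μ i = 1 ∧ toR3 m = ∑ i, μ i • toR3 (v i) ∧
      ∃ i, Int.fract (μ i) ≠ 0 := by
  by_contra hcon
  push Not at hcon
  apply h1
  have hex : ∀ k : Fin 3, ∃ n : Fin 4 → ℤ, ∑ i, n i = 1 ∧ v 0 + Pi.single k 1 = ∑ i, n i • v i := by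
    intro k
    obtain ⟨μ, hμ, hb⟩ := exists_bary v hD (toR3 (v 0 + Pi.single k 1))
    have hfr := hcon _ μ hμ hb
    have hfl : ∀ i, μ i = (⌊μ i⌋ : ℝ) := by
      intro i; have := Int.floor_add_fract (μ i); rw [hfr i, add_zero] at this; exact this.symm
    refine ⟨fun i => ⌊μ i⌋, ?_, ?_⟩
    · have : (((∑ i, ⌊μ i⌋ : ℤ)) : ℝ) = 1 := by
        push_cast; rw [← hμ]; exact Finset.sum_congr rfl fun i _ => (hfl i).symm
      exact_mod_cast this
    · apply toR3_inj
      rw [hb]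
      ext j
      simp only [toR3, Finset.sum_apply, Pi.smul_apply, smul_eq_mul]
      push_cast
      exact Finset.sum_congr rfl fun i _ => by rw [← hfl i]
  choose n hn1 hn2 using hex
  set A : Matrix (Fin 3) (Fin 3) ℤ := Matrix.of ![v 1 - v 0, v 2 - v 0, v 3 - v 0] with hA
  set N : Matrix (Fin 3) (Fin 3) ℤ := Matrix.of fun k j => n k j.succ with hN
  have hNA : N * A = 1 := by
    ext k j
    have e := congrFun (hn2 k) j
    have s := hn1 k
    simp only [Fin.sum_univ_four, Pi.add_apply, Pi.smul_apply, smul_eq_mul] at e s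
    simp only [Matrix.mul_apply, Fin.sum_univ_three, hN, hA, Matrix.of_apply, Matrix.one_apply]
    have e2 : (Pi.single k (1:ℤ) : Fin 3 → ℤ) j = if k = j then 1 else 0 := by
      by_cases hkj : k = j
      · subst hkj; simp
      · simp [hkj, Ne.symm hkj]
    rw [← e2]
    simp
    have s0 : n k 0 = 1 - n k 1 - n k 2 - n k 3 := by linarith
    rw [s0] at e
    have f1 : (Fin.succ 0 : Fin 4) = 1 := rfl
    have f2 : (Fin.succ 1 : Fin 4) = 2 := rfl
    have f3 : (Fin.succ 2 : Fin 4) = 3 := rfl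
    linarith
  have hu : IsUnit A.det := by
    have := congrArg Matrix.det hNA
    rw [Matrix.det_mul, Matrix.det_one] at this
    exact IsUnit.of_mul_eq_one_right _ this
  rw [Int.isUnit_iff, hA, det3_eq] at hu
  exact hu


lemma oneD_a {l0 li lj lk v0 vi vj vk : ℝ} (hs : l0 + li + lj + lk = 2) (h0 : 0 < l0)
    (hi : l0 ≤ li) (hj : l0 ≤ lj) (hk : l0 ≤ lk) (hk' : l0 ≤ 1 - lk)
    (b0 : 0 ≤ v0 ∧ v0 ≤ 1) (bi : 0 ≤ vi ∧ vi ≤ 1) (bj : 0 ≤ vj ∧ vj ≤ 1) (bk : 0 ≤ vk ∧ vk ≤ 1)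
    (f1 : ¬ (0 ≤ l0 * v0 + li * vi + lj * vj + lk * vk - vi ∧
      l0 * v0 + li * vi + lj * vj + lk * vk - vi ≤ 1))
    (f2 : ¬ (0 ≤ l0 * v0 + li * vi + lj * vj + lk * vk - vj ∧
      l0 * v0 + li * vi + lj * vj + lk * vk - vj ≤ 1)) : False := by
  have core : ∀ v0 vi vj vk : ℝ, 0 ≤ v0 → 0 ≤ vi → 0 ≤ vj → 0 ≤ vk →
      l0 * v0 + li * vi + lj * vj + lk * vk < vi →
      l0 * v0 + li * vi + lj * vj + lk * vk < vj → False := by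
    intro v0 vi vj vk b0 bi bj bk h1 h2
    set y := l0 * v0 + li * vi + lj * vj + lk * vk with hy
    have e0 := mul_nonneg h0.le b0
    have ek := mul_nonneg (h0.le.trans hk) bk
    have ei := mul_pos (h0.trans_le hi) (sub_pos.2 h1)
    have ej := mul_pos (h0.trans_le hj) (sub_pos.2 h2)
    have ei' := mul_nonneg (h0.le.trans hi) bi
    have ej' := mul_nonneg (h0.le.trans hj) bj
    have y0 : 0 ≤ y := by linarith
    have : 0 ≤ (li + lj - 1) * y := mul_nonneg (by linarith) y0
    nlinarith
  rw [not_and_or, not_le, not_le] at f1 f2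
  rcases f1 with f1 | f1 <;> rcases f2 with f2 | f2
  · exact core v0 vi vj vk b0.1 bi.1 bj.1 bk.1 (by linarith) (by linarith)
  · linarith [bi.2, bj.1]
  · linarith [bj.2, bi.1]
  · refine core (1 - v0) (1 - vi) (1 - vj) (1 - vk) (by linarith) (by linarith) (by linarith)
      (by linarith) ?_ ?_ <;> nlinarith

lemma oneD_b {l0 li lj lk v0 vi vj vk : ℝ} (hs : l0 + li + lj + lk = 2) (h0 : 0 < l0)
    (hi' : l0 ≤ 1 - li) (hj' : l0 ≤ 1 - lj) (hk' : l0 ≤ 1 - lk)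
    (b0 : 0 ≤ v0 ∧ v0 ≤ 1) (bi : 0 ≤ vi ∧ vi ≤ 1) (bj : 0 ≤ vj ∧ vj ≤ 1) (bk : 0 ≤ vk ∧ vk ≤ 1)
    (f1 : ¬ (0 ≤ l0 * v0 + li * vi + lj * vj + lk * vk - vi ∧
      l0 * v0 + li * vi + lj * vj + lk * vk - vi ≤ 1))
    (f2 : ¬ (0 ≤ (1 - l0) * v0 + (1 - li) * vi + (1 - lj) * vj + (1 - lk) * vk - v0 ∧
      (1 - l0) * v0 + (1 - li) * vi + (1 - lj) * vj + (1 - lk) * vk - v0 ≤ 1)) : False := by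
  have core : ∀ v0 vi vj vk : ℝ, (0 ≤ v0 ∧ v0 ≤ 1) → (0 ≤ vi ∧ vi ≤ 1) → (0 ≤ vj ∧ vj ≤ 1) →
      (0 ≤ vk ∧ vk ≤ 1) →
      l0 * v0 + li * vi + lj * vj + lk * vk < vi →
      v0 < (1 - l0) * v0 + (1 - li) * vi + (1 - lj) * vj + (1 - lk) * vk - 1 → False := by
    intro v0 vi vj vk b0 bi bj bk h1 h2
    have ei := mul_nonneg (sub_nonneg.2 hi') (sub_nonneg.2 bi.2)
    have ej := mul_nonneg (sub_nonneg.2 hj') (sub_nonneg.2 bj.2)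
    have ek := mul_nonneg (sub_nonneg.2 hk') (sub_nonneg.2 bk.2)
    have key : 0 < l0 * (vi + vj + vk - 2 - v0) := by nlinarith
    have key2 : 0 < vi + vj + vk - 2 - v0 := by
      by_contra hc
      nlinarith
    have m : 0 < 1 - l0 := by linarith
    have := mul_pos m key2
    nlinarith [mul_nonneg (show 0 ≤ 2 - l0 - li by linarith) (sub_nonneg.2 bi.2)]
  rw [not_and_or, not_le, not_le] at f1 f2
  rcases f1 with f1 | f1 <;> rcases f2 with f2 | f2
  · nlinarith [bj.1, bk.1]
  · exact core v0 vi vj vk b0 bi bj bk (by linarith) (by linarith)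
  · refine core (1 - v0) (1 - vi) (1 - vj) (1 - vk) ⟨by linarith, by linarith⟩
      ⟨by linarith, by linarith⟩ ⟨by linarith, by linarith⟩
      ⟨by linarith, by linarith⟩ ?_ ?_ <;> nlinarith
  · nlinarith [bj.2, bk.2]

lemma fourth (a i j : Fin 4) (h1 : a ≠ i) (h2 : a ≠ j) (h3 : i ≠ j) :
    ∃ k, ∀ f : Fin 4 → ℝ, ∑ x, f x = f a + f i + f j + f k := by
  have : ∃ k, k ≠ a ∧ k ≠ i ∧ k ≠ j := by
    revert a i j; decide
  obtain ⟨k, ka, ki, kj⟩ := this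
  refine ⟨k, fun f => ?_⟩
  have hu : (Finset.univ : Finset (Fin 4)) = {a, i, j, k} := by
    revert a i j k; decide
  rw [hu, Finset.sum_insert, Finset.sum_insert, Finset.sum_insert, Finset.sum_singleton]
  · ring
  · simp [kj.symm]
  · simp [h3, ki.symm]
  · simp [h1, h2, ka.symm]

lemma box_lemma (s : Fin 4 → Fin 3 → ℝ) (hs : ∀ i k, 0 ≤ s i k ∧ s i k ≤ 1) (l : Fin 4 → ℝ)
    (hl : ∑ i, l i = 2) (a : Fin 4) (ha : 0 < l a) (hmin : ∀ j, l a ≤ l j ∧ l a ≤ 1 - l j) :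
    (∃ i, ∀ k, 0 ≤ ∑ j, l j * s j k - s i k ∧ ∑ j, l j * s j k - s i k ≤ 1) ∨
    (∀ k, 0 ≤ ∑ j, (1 - l j) * s j k - s a k ∧ ∑ j, (1 - l j) * s j k - s a k ≤ 1) := by
  by_contra hcon
  rw [not_or] at hcon
  obtain ⟨c1, c2⟩ := hcon
  simp only [not_exists, not_forall] at c1 c2
  choose k hk using c1
  obtain ⟨k', hk'⟩ := c2
  have hA : ∀ i j, a ≠ i → a ≠ j → i ≠ j → k i ≠ k j := by
    intro i j h1 h2 h3 he
    obtain ⟨m, hm⟩ := fourth a i j h1 h2 h3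
    have fi := hk i
    have fj := hk j
    rw [← he] at fj
    rw [hm] at fi fj hl
    exact oneD_a hl ha (hmin i).1 (hmin j).1 (hmin m).1 (hmin m).2 (hs a _) (hs i _) (hs j _) (hs m _)
      fi fj
  have hB : ∀ i, a ≠ i → k i ≠ k' := by
    intro i h1 he
    have : ∃ j, a ≠ j ∧ i ≠ j := by
      clear * - h1; revert a i; decide
    obtain ⟨j, h2, h3⟩ := this
    obtain ⟨m, hm⟩ := fourth a i j h1 h2 h3
    have fi := hk i
    rw [he] at fi
    rw [hm] at fi hk' hl
    exact oneD_b hl ha (hmin i).2 (hmin j).2 (hmin m).2 (hs a _) (hs i _) (hs j _) (hs m _)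
      fi hk'
  -- pigeonhole
  have hinj : Function.Injective (fun i => if a = i then (3 : Fin 4) else (k i).castSucc) := by
    intro i j hij
    by_cases h1 : a = i <;> by_cases h2 : a = j
    · exact h1.symm.trans h2
    · simp only [h1, if_true] at hij
      rw [if_neg (by rw [← h1]; exact h2)] at hij
      exact absurd hij.symm (Fin.castSucc_lt_last _).ne
    · simp only [h2, if_true] at hij
      rw [if_neg (by rw [← h2]; exact h1)] at hij
      exact absurd hij (Fin.castSucc_lt_last _).ne
    · simp only [h1, h2, if_false] at hij
      by_contra h3
      exact hA i j h1 h2 h3 (Fin.castSucc_injective _ hij)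
  have hsurj := Finite.surjective_of_injective hinj
  obtain ⟨i, hi⟩ := hsurj k'.castSucc
  by_cases h1 : a = i
  · simp only [h1, if_true] at hi
    exact absurd hi.symm (Fin.castSucc_lt_last _).ne
  · simp only [h1, if_false] at hi
    exact hB i h1 (Fin.castSucc_injective _ hi)

/-- real parallelepiped -/
def Box (a u w r : Fin 3 → ℝ) : Set (Fin 3 → ℝ) :=
  {x | ∃ s : Fin 3 → ℝ, (∀ k, 0 ≤ s k ∧ s k ≤ 1) ∧ x = a + s 0 • u + s 1 • w + s 2 • r}

lemma box_convex (a u w r : Fin 3 → ℝ) : Convex ℝ (Box a u w r) := by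
  rintro x ⟨s, hs, rfl⟩ y ⟨t, ht, rfl⟩ p q hp hq hpq
  refine ⟨fun k => p * s k + q * t k, fun k => ⟨?_, ?_⟩, ?_⟩
  · have := mul_nonneg hp (hs k).1; have := mul_nonneg hq (ht k).1; linarith
  · have := mul_le_mul_of_nonneg_left (hs k).2 hp
    have := mul_le_mul_of_nonneg_left (ht k).2 hq; linarith
  · have : q = 1 - p := by linarith
    subst this
    ext k; simp; ring

lemma box_comb {a u w r : Fin 3 → ℝ} {v : Fin 4 → Fin 3 → ℝ} {s : Fin 4 → Fin 3 → ℝ}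
    (h : ∀ i, v i = a + s i 0 • u + s i 1 • w + s i 2 • r) (κ : Fin 4 → ℝ) (hκ : ∑ i, κ i = 1)
    (hb : ∀ k, 0 ≤ ∑ j, κ j * s j k ∧ ∑ j, κ j * s j k ≤ 1) :
    ∑ i, κ i • v i ∈ Box a u w r := by
  refine ⟨fun k => ∑ j, κ j * s j k, hb, ?_⟩
  have h0 : κ 0 = 1 - κ 1 - κ 2 - κ 3 := by rw [Fin.sum_univ_four] at hκ; linarith
  ext k
  simp [Fin.sum_univ_four, h, h0]
  ring

lemma sum_lt_card_zero {l : Fin 4 → ℝ} (h : ∀ i, l i < 1) (i : Fin 4) (hi : l i = 0) :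
    ∑ j, l j < 3 := by
  have : ∑ j, l j < ∑ j, (if j = i then (0:ℝ) else 1) := by
    apply Finset.sum_lt_sum
    · intro j _
      by_cases hj : j = i
      · subst hj; simp [hi]
      · simp [hj, (h j).le]
    · obtain ⟨j, hj⟩ := exists_ne i
      exact ⟨j, Finset.mem_univ _, by simp [hj, h j]⟩
  refine this.trans_le ?_
  rw [Fin.sum_univ_four]
  fin_cases i <;> simp <;> norm_num

/-- The descent step inside a parallelepiped. -/
lemma box_step (a u w r : Fin 3 → ℝ) (v : Fin 4 → Fin 3 → ℤ) (hD : tdet v ≠ 0)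
    (hn : ¬ (tdet v = 1 ∨ tdet v = -1)) (hv : ∀ i, toR3 (v i) ∈ Box a u w r) :
    ∃ (q : Fin 3 → ℤ) (κ : Fin 4 → ℝ), ∑ i, κ i = 1 ∧ (∀ i, κ i < 1) ∧
      toR3 q = ∑ i, κ i • toR3 (v i) ∧ toR3 q ∈ Box a u w r := by
  obtain ⟨m, μ, hμ, hm, i0, hi0⟩ := exists_nonint v hD hn
  set l : Fin 4 → ℝ := fun i => Int.fract (μ i) with hl
  have l0 : ∀ i, 0 ≤ l i := fun i => Int.fract_nonneg _
  have l1 : ∀ i, l i < 1 := fun i => Int.fract_lt_one _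
  set Y : Fin 3 → ℤ := m - ∑ i, ⌊μ i⌋ • v i with hY
  have hμl : ∀ i, μ i = ⌊μ i⌋ + l i := fun i => (Int.floor_add_fract _).symm
  have hYl : toR3 Y = ∑ i, l i • toR3 (v i) := by
    rw [hY, toR3_sub, hm]
    ext k
    simp [toR3, Fin.sum_univ_four]
    have g : ∀ i, l i = μ i - ⌊μ i⌋ := fun i => by linarith [hμl i]
    rw [g 0, g 1, g 2, g 3]; ring
  obtain ⟨n, hn⟩ : ∃ n : ℤ, ∑ i, l i = n := by
    refine ⟨1 - ∑ i, ⌊μ i⌋, ?_⟩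
    push_cast
    rw [← hμ, ← Finset.sum_sub_distrib]
    exact Finset.sum_congr rfl fun i _ => by linarith [hμl i]
  have hpos : 0 < ∑ i, l i :=
    Finset.sum_pos' (fun i _ => l0 i) ⟨i0, Finset.mem_univ _, lt_of_le_of_ne (l0 i0) (Ne.symm hi0)⟩
  have hlt : ∑ i, l i < 4 := by
    have := Finset.sum_lt_sum_of_nonempty (s := Finset.univ) Finset.univ_nonempty (fun i (_ : i ∈ _) => l1 i)
    simpa using this
  have hcomp : toR3 (∑ i, v i - Y) = ∑ i, (1 - l i) • toR3 (v i) := by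
    rw [toR3_sub, hYl]
    ext k
    simp [toR3, Fin.sum_univ_four]; ring
  have n1 : 0 < n := by rw [hn] at hpos; exact_mod_cast hpos
  have n4 : n < 4 := by rw [hn] at hlt; exact_mod_cast hlt
  have hcv : ∀ (q : Fin 3 → ℤ) (κ : Fin 4 → ℝ), ∑ i, κ i = 1 → (∀ i, 0 ≤ κ i) →
      toR3 q = ∑ i, κ i • toR3 (v i) → toR3 q ∈ Box a u w r := by
    intro q κ h1 h2 h3
    rw [h3]
    exact (box_convex a u w r).sum_mem (fun i _ => h2 i) h1 (fun i _ => hv i)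
  interval_cases n
  · refine ⟨Y, l, by simpa using hn, l1, hYl, hcv Y l (by simpa using hn) l0 hYl⟩
  · by_cases hz : ∃ i, l i = 0
    · obtain ⟨i, hi⟩ := hz
      have hne : ∀ j, j ≠ i → 0 < l j := by
        intro j hj
        refine lt_of_le_of_ne (l0 j) fun h => ?_
        have : ∑ x, l x < ∑ x, (if x = i ∨ x = j then (0:ℝ) else 1) := by
          apply Finset.sum_lt_sum
          · intro x _
            by_cases hx : x = i ∨ x = j
            · rcases hx with rfl | rfl
              · simp [hi]
              · simp [← h]
            · simp [hx, (l1 x).le]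
          · obtain ⟨x, hx⟩ : ∃ x, ¬ (x = i ∨ x = j) := by
              clear * -; revert i j; decide
            exact ⟨x, Finset.mem_univ _, by simp [hx, l1 x]⟩
        rw [hn] at this
        have h2 : ∑ x, (if x = i ∨ x = j then (0:ℝ) else 1) = 2 := by
          rw [Fin.sum_univ_four]
          clear * - hj
          fin_cases i <;> fin_cases j <;> simp at hj ⊢ <;> norm_num
        rw [h2] at this
        norm_num at this
      have e1 : ∑ j, (1 - l j - if j = i then (1:ℝ) else 0) = 1 := by
        rw [Finset.sum_sub_distrib, Finset.sum_sub_distrib, hn]; simp; norm_num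
      have e2 : toR3 (∑ i, v i - Y - v i) = ∑ j, (1 - l j - if j = i then (1:ℝ) else 0) • toR3 (v j) := by
        rw [toR3_sub, hcomp]
        simp only [sub_smul _ (ite _ _ _), Finset.sum_sub_distrib, ite_smul, zero_smul, one_smul]
        simp
      refine ⟨∑ i, v i - Y - v i, fun j => 1 - l j - if j = i then (1:ℝ) else 0, e1, ?_, e2,
        hcv _ _ e1 ?_ e2⟩
      · intro j
        by_cases hj : j = i
        · subst hj; simp [hi]
        · simp [hj, hne j hj]
      · intro j
        by_cases hj : j = i
        · subst hj; simp [hi]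
        · simp [hj, (l1 j).le]
    · push Not at hz
      have lp : ∀ i, 0 < l i := fun i => lt_of_le_of_ne (l0 i) (Ne.symm (hz i))
      choose s hs hsv using hv
      -- general form
      have gen : ∀ (L : Fin 4 → ℝ) (Z : Fin 3 → ℤ) (i : Fin 4), (∀ i, 0 < L i) → (∀ i, L i < 1) →
          ∑ i, L i = 2 → toR3 Z = ∑ i, L i • toR3 (v i) →
          (∀ k, 0 ≤ ∑ j, L j * s j k - s i k ∧ ∑ j, L j * s j k - s i k ≤ 1) →
          ∃ (q : Fin 3 → ℤ) (κ : Fin 4 → ℝ), ∑ i, κ i = 1 ∧ (∀ i, κ i < 1) ∧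
            toR3 q = ∑ i, κ i • toR3 (v i) ∧ toR3 q ∈ Box a u w r := by
        intro L Z i h0 h1 h2 h3 h4
        have e1 : ∑ j, (L j - if j = i then (1:ℝ) else 0) = 1 := by
          rw [Finset.sum_sub_distrib, h2]; simp; norm_num
        have e2 : toR3 (Z - v i) = ∑ j, (L j - if j = i then (1:ℝ) else 0) • toR3 (v j) := by
          rw [toR3_sub, h3]
          simp only [sub_smul, Finset.sum_sub_distrib, ite_smul, zero_smul, one_smul]
          simp
        refine ⟨Z - v i, fun j => L j - if j = i then (1:ℝ) else 0, e1, ?_, e2, ?_⟩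
        · intro j
          have := h1 j
          by_cases hj : j = i <;> simp [hj]
          · rw [← hj]; linarith
          · exact this
        · rw [e2]
          apply box_comb hsv _ e1
          intro k
          have : ∑ j, (L j - if j = i then (1:ℝ) else 0) * s j k = ∑ j, L j * s j k - s i k := by
            simp only [sub_mul, Finset.sum_sub_distrib, ite_mul, zero_mul, one_mul]
            simp
          rw [this]; exact h4 k
      have cs : ∑ i, (1 - l i) = 2 := by rw [Finset.sum_sub_distrib, hn]; simp; norm_num
      have both : ∀ (L : Fin 4 → ℝ) (Z Z' : Fin 3 → ℤ) (i : Fin 4), (∀ i, 0 < L i) → (∀ i, L i < 1) →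
          ∑ i, L i = 2 → ∑ i, (1 - L i) = 2 → toR3 Z = ∑ i, L i • toR3 (v i) →
          toR3 Z' = ∑ i, (1 - L i) • toR3 (v i) → (∀ j, L i ≤ L j ∧ L i ≤ 1 - L j) →
          ∃ (q : Fin 3 → ℤ) (κ : Fin 4 → ℝ), ∑ i, κ i = 1 ∧ (∀ i, κ i < 1) ∧
            toR3 q = ∑ i, κ i • toR3 (v i) ∧ toR3 q ∈ Box a u w r := by
        intro L Z Z' i h0 h1 h2 h2' h3 h3' hmin
        rcases box_lemma s hs L h2 i (h0 i) hmin with ⟨j, hj⟩ | hj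
        · exact gen L Z j h0 h1 h2 h3 hj
        · exact gen (fun i => 1 - L i) Z' i (fun i => by linarith [h1 i]) (fun i => by linarith [h0 i])
            h2' h3' hj
      obtain ⟨i, -, hi⟩ := Finset.exists_min_image Finset.univ (fun i => min (l i) (1 - l i))
        Finset.univ_nonempty
      have hi' : ∀ j, min (l i) (1 - l i) ≤ l j ∧ min (l i) (1 - l i) ≤ 1 - l j := fun j =>
        ⟨(hi j (Finset.mem_univ _)).trans (min_le_left _ _),
          (hi j (Finset.mem_univ _)).trans (min_le_right _ _)⟩
      rcases le_total (l i) (1 - l i) with h | h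
      · rw [min_eq_left h] at hi'
        exact both l Y (∑ i, v i - Y) i lp l1 (by simpa using hn) cs hYl hcomp hi'
      · rw [min_eq_right h] at hi'
        refine both (fun i => 1 - l i) (∑ i, v i - Y) Y i (fun i => by linarith [l1 i])
          (fun i => by linarith [lp i]) cs (by simpa using hn) hcomp (by simpa using hYl) ?_
        intro j
        refine ⟨(hi' j).2, ?_⟩
        have := (hi' j).1
        simpa using this
  · have lp : ∀ i, 0 < l i := by
      intro i
      refine lt_of_le_of_ne (l0 i) fun h => ?_
      have := sum_lt_card_zero l1 i h.symm
      rw [hn] at this; norm_num at this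
    have e1 : ∑ i, (1 - l i) = 1 := by rw [Finset.sum_sub_distrib, hn]; simp; norm_num
    exact ⟨∑ i, v i - Y, fun i => 1 - l i, e1, fun i => by linarith [lp i], hcomp,
      hcv _ _ e1 (fun i => by linarith [l1 i]) hcomp⟩

lemma box_descent (a u w r : Fin 3 → ℝ) (x : Fin 3 → ℝ) (n : ℕ) : ∀ (v : Fin 4 → Fin 3 → ℤ),
    (tdet v).natAbs = n → tdet v ≠ 0 → (∀ i, toR3 (v i) ∈ Box a u w r) → InTet v x →
    Cov (Box a u w r) x := by
  induction n using Nat.strong_induction_on with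
  | _ n ih =>
    intro v hvn hD hv hx
    by_cases h1 : tdet v = 1 ∨ tdet v = -1
    · exact ⟨v, hv, h1, hx⟩
    · obtain ⟨q, κ, k1, k2, k3, k4⟩ := box_step a u w r v hD h1 hv
      obtain ⟨i, -, j1, j2, j3⟩ := flip_lt v hD q κ k1 k2 k3 x hx
      refine ih _ (by rw [← hvn]; exact j2) _ rfl j1 ?_ j3
      intro j
      by_cases hj : j = i
      · subst hj; simpa using k4
      · rw [Function.update_of_ne hj]; exact hv j


lemma kuhn_sorted (a e0 e1 e2 : Fin 3 → ℤ) (t0 t1 t2 : ℝ) (h0 : t0 ≤ 1) (h01 : t1 ≤ t0)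
    (h12 : t2 ≤ t1) (h2 : 0 ≤ t2) (x : Fin 3 → ℝ)
    (hx : x = toR3 a + t0 • toR3 e0 + t1 • toR3 e1 + t2 • toR3 e2) :
    InTet ![a, a + e0, a + e0 + e1, a + e0 + e1 + e2] x := by
  refine ⟨![1 - t0, t0 - t1, t1 - t2, t2], ?_, ?_, ?_⟩
  · intro i; fin_cases i <;> simp <;> linarith
  · simp [Fin.sum_univ_four]
  · rw [hx]; ext k; simp [Fin.sum_univ_four, toR3]; ring

lemma kuhn_tdet (a e0 e1 e2 : Fin 3 → ℤ) :
    tdet ![a, a + e0, a + e0 + e1, a + e0 + e1 + e2] = det3 e0 e1 e2 := by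
  simp [tdet, det3]; ring

lemma box_perm1 (a u w r : Fin 3 → ℝ) : Box a u w r = Box a w u r := by
  ext x; constructor <;> rintro ⟨s, hs, rfl⟩ <;>
  refine ⟨![s 1, s 0, s 2], fun k => ?_, ?_⟩
  · fin_cases k <;> simp [hs]
  · simp; abel
  · fin_cases k <;> simp [hs]
  · simp; abel

lemma box_perm2 (a u w r : Fin 3 → ℝ) : Box a u w r = Box a u r w := by
  ext x; constructor <;> rintro ⟨s, hs, rfl⟩ <;>
  refine ⟨![s 0, s 2, s 1], fun k => ?_, ?_⟩
  · fin_cases k <;> simp [hs]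
  · simp; abel
  · fin_cases k <;> simp [hs]
  · simp; abel

lemma kuhn_box (a e0 e1 e2 : Fin 3 → ℤ) (hd : det3 e0 e1 e2 ≠ 0) (t0 t1 t2 : ℝ) (h0 : t0 ≤ 1)
    (h01 : t1 ≤ t0) (h12 : t2 ≤ t1) (h2 : 0 ≤ t2) (x : Fin 3 → ℝ)
    (hx : x = toR3 a + t0 • toR3 e0 + t1 • toR3 e1 + t2 • toR3 e2) :
    Cov (Box (toR3 a) (toR3 e0) (toR3 e1) (toR3 e2)) x := by
  refine box_descent _ _ _ _ x _ _ rfl ?_ ?_ (kuhn_sorted a e0 e1 e2 t0 t1 t2 h0 h01 h12 h2 x hx)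
  · rw [kuhn_tdet]; exact hd
  · intro i
    fin_cases i
    · exact ⟨![0,0,0], fun k => by fin_cases k <;> simp, by simp⟩
    · exact ⟨![1,0,0], fun k => by fin_cases k <;> simp, by simp [toR3_add]⟩
    · exact ⟨![1,1,0], fun k => by fin_cases k <;> simp, by simp [toR3_add]⟩
    · exact ⟨![1,1,1], fun k => by fin_cases k <;> simp, by simp [toR3_add]⟩

lemma box_cov (a u w r : Fin 3 → ℤ) (hd : det3 u w r ≠ 0) (x : Fin 3 → ℝ)
    (hx : x ∈ Box (toR3 a) (toR3 u) (toR3 w) (toR3 r)) :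
    Cov (Box (toR3 a) (toR3 u) (toR3 w) (toR3 r)) x := by
  obtain ⟨s, hs, hx⟩ := hx
  have p1 : ∀ u w r : Fin 3 → ℤ, det3 u w r = - det3 w u r := by intros; simp [det3]; ring
  have p2 : ∀ u w r : Fin 3 → ℤ, det3 u w r = - det3 u r w := by intros; simp [det3]; ring
  rcases le_total (s 0) (s 1) with h | h <;> rcases le_total (s 1) (s 2) with h' | h' <;>
    rcases le_total (s 0) (s 2) with h'' | h''
  · rw [box_perm1, box_perm2, box_perm1]
    refine kuhn_box a r w u ?_ (s 2) (s 1) (s 0) (hs _).2 h' h (hs _).1 x ?_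
    · rw [p1, p2, p1]; simpa using hd
    · rw [hx]; abel
  · rw [box_perm1, box_perm2, box_perm1]
    refine kuhn_box a r w u ?_ (s 2) (s 1) (s 0) (hs _).2 h' h (hs _).1 x ?_
    · rw [p1, p2, p1]; simpa using hd
    · rw [hx]; abel
  · rw [box_perm1, box_perm2]
    refine kuhn_box a w r u ?_ (s 1) (s 2) (s 0) (hs _).2 h' h'' (hs _).1 x ?_
    · rw [p2, p1]; simpa using hd
    · rw [hx]; abel
  · rw [box_perm1]
    refine kuhn_box a w u r ?_ (s 1) (s 0) (s 2) (hs _).2 h h'' (hs _).1 x ?_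
    · rw [p1]; simpa using hd
    · rw [hx]; abel
  · rw [box_perm2, box_perm1]
    refine kuhn_box a r u w ?_ (s 2) (s 0) (s 1) (hs _).2 h'' h (hs _).1 x ?_
    · rw [p1, p2]; simpa using hd
    · rw [hx]; abel
  · rw [box_perm2]
    refine kuhn_box a u r w ?_ (s 0) (s 2) (s 1) (hs _).2 h'' h' (hs _).1 x ?_
    · rw [p2]; simpa using hd
    · rw [hx]; abel
  · exact kuhn_box a u w r hd (s 0) (s 1) (s 2) (hs _).2 h h' (hs _).1 x hx
  · exact kuhn_box a u w r hd (s 0) (s 1) (s 2) (hs _).2 h h' (hs _).1 x hx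

lemma Cov.mono {P Q : Set (Fin 3 → ℝ)} (h : P ⊆ Q) {x} (hx : Cov P x) : Cov Q x := by
  obtain ⟨v, h1, h2⟩ := hx
  exact ⟨v, fun i => h (h1 i), h2⟩

lemma conv2 {P : Set (Fin 3 → ℝ)} (hc : Convex ℝ P) {x y : Fin 3 → ℝ} (hx : x ∈ P) (hy : y ∈ P)
    {s : ℝ} (h0 : 0 ≤ s) (h1 : s ≤ 1) : (1 - s) • x + s • y ∈ P :=
  hc hx hy (by linarith) h0 (by ring)

/-- Parallelogram lemma -/
lemma par_cov {P : Set (Fin 3 → ℝ)} (hc : Convex ℝ P) (C : Fin 3 → ℤ)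
    (hC : ∀ x, x ∈ P → toR3 C - x ∈ P) (a u w : Fin 3 → ℤ)
    (h0 : toR3 a ∈ P) (h1 : toR3 (a + u) ∈ P) (h2 : toR3 (a + w) ∈ P) (h3 : toR3 (a + u + w) ∈ P)
    (hd : det3 u w (C - 2 • a) ≠ 0) (s1 s2 τ : ℝ) (hs1 : 0 ≤ s1 ∧ s1 ≤ 1) (hs2 : 0 ≤ s2 ∧ s2 ≤ 1)
    (hτ : 0 ≤ τ ∧ τ ≤ 1) (x : Fin 3 → ℝ)
    (hx : x = (1 - τ) • ((1/2 : ℝ) • toR3 C) + τ • (toR3 a + s1 • toR3 u + s2 • toR3 w)) :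
    Cov P x := by
  have hb : Box (toR3 a) (toR3 u) (toR3 w) (toR3 (C - 2 • a - u - w)) ⊆ P := by
    rintro y ⟨s, hs, rfl⟩
    have k0 := hC _ h0
    have k1 := hC _ h1
    have k2 := hC _ h2
    have k3 := hC _ h3
    have A := conv2 hc (conv2 hc h0 h1 (hs 0).1 (hs 0).2) (conv2 hc h2 h3 (hs 0).1 (hs 0).2) (hs 1).1 (hs 1).2
    have B := conv2 hc (conv2 hc k3 k2 (hs 0).1 (hs 0).2) (conv2 hc k1 k0 (hs 0).1 (hs 0).2) (hs 1).1 (hs 1).2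
    have D := conv2 hc A B (hs 2).1 (hs 2).2
    convert D using 1
    ext k; simp [toR3]; ring
  refine (box_cov a u w (C - 2 • a - u - w) ?_ x ⟨![τ * s1 + (1 - τ)/2, τ * s2 + (1 - τ)/2, (1 - τ)/2], ?_, ?_⟩).mono hb
  · intro h; apply hd; rw [← h]; simp [det3]; ring
  · intro k
    have := mul_nonneg hτ.1 hs1.1
    have := mul_nonneg hτ.1 hs2.1
    have := mul_le_mul_of_nonneg_left hs1.2 hτ.1
    have := mul_le_mul_of_nonneg_left hs2.2 hτ.1
    fin_cases k <;> simp <;> constructor <;> linarith [hτ.1, hτ.2]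
  · rw [hx]; ext k; simp [toR3]; ring


lemma edge_dirs {X P : Set (Fin 3 → ℝ)} (hX : X.Finite) (hP : P = convexHull ℝ X) {v : Fin 3 → ℝ}
    (hv : v ∈ Set.extremePoints ℝ P) (hne : ∃ x ∈ X, x ≠ v) :
    ∃ D : Set (Fin 3 → ℝ), (∀ e ∈ D, ∃ T : ℝ, 0 < T ∧ IsEdge P v (v + T • e)) ∧
      ∀ x ∈ P, ∃ t : ℝ, 0 ≤ t ∧ ∃ y ∈ convexHull ℝ D, x - v = t • y := by
  have hPc : Convex ℝ P := hP ▸ convex_convexHull ℝ _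
  have hPk : IsCompact P := hP ▸ hX.isCompact_convexHull ℝ
  have hXP : X ⊆ P := hP ▸ subset_convexHull ℝ X
  have hvn : v ∉ convexHull ℝ (X \ {v}) := by
    have := (hPc.mem_extremePoints_iff_mem_sdiff_convexHull_sdiff.1 hv).2
    exact fun h => this (convexHull_mono (Set.sdiff_subset_sdiff_left hXP) h)
  have hXf : (X \ {v}).Finite := hX.subset Set.sdiff_subset
  obtain ⟨f, u, hfu, hfX⟩ := geometric_hahn_banach_point_closed (convex_convexHull ℝ (X \ {v}))
    (hXf.isClosed_convexHull ℝ) hvn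
  have hpos : ∀ x ∈ X, x ≠ v → 0 < f (x - v) := by
    intro x hx hxv
    have := hfX x (subset_convexHull ℝ _ ⟨hx, hxv⟩)
    rw [map_sub]; linarith
  set g : (Fin 3 → ℝ) → (Fin 3 → ℝ) := fun x => (1 / f (x - v)) • (x - v) with hg
  set Y := g '' (X \ {v}) with hY
  have hYf : Y.Finite := hXf.image g
  set Q := convexHull ℝ Y with hQ
  have hfQ : ∀ y ∈ Q, f y = 1 := by
    intro y hy
    have hcv : Convex ℝ {y | f y = 1} := by
      intro a ha b hb p q _ _ hpq
      simp only [Set.mem_ofPred_eq] at *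
      simp [ha, hb, hpq]
    refine (convexHull_min ?_ hcv) hy
    rintro _ ⟨x, ⟨hx, hxv⟩, rfl⟩
    have := hpos x hx hxv
    simp only [hg, Set.mem_ofPred_eq, map_smul, smul_eq_mul]
    field_simp
  have hcone : ∀ x ∈ P, ∃ t : ℝ, 0 ≤ t ∧ ∃ y ∈ Q, x - v = t • y := by
    have hcv : Convex ℝ {x | ∃ t : ℝ, 0 ≤ t ∧ ∃ y ∈ Q, x - v = t • y} := by
      rintro a ⟨s, hs, y, hy, ha⟩ b ⟨t, ht, z, hz, hb⟩ p q hp hq hpq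
      have e : p • a + q • b - v = (p * s) • y + (q * t) • z := by
        rw [mul_smul, mul_smul, ← ha, ← hb]
        have : q = 1 - p := by linarith
        subst this
        ext k; simp; ring
      have h1 := mul_nonneg hp hs
      have h2 := mul_nonneg hq ht
      by_cases h0 : p * s + q * t = 0
      · have z1 : p * s = 0 := by linarith
        have z2 : q * t = 0 := by linarith
        exact ⟨0, le_rfl, y, hy, by rw [e, z1, z2]; simp⟩
      · have hp' : 0 < p * s + q * t := lt_of_le_of_ne (by linarith) (Ne.symm h0)
        refine ⟨p * s + q * t, hp'.le, ((p * s) / (p * s + q * t)) • y + ((q * t) / (p * s + q * t)) • z,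
          (convex_convexHull ℝ Y) hy hz (by positivity) (by positivity) (by field_simp), ?_⟩
        rw [e]; ext k; simp; field_simp
    intro x hx
    rw [hP] at hx
    refine convexHull_min ?_ hcv hx
    intro y hy
    by_cases hyv : y = v
    · obtain ⟨x0, hx0, hx0v⟩ := hne
      exact ⟨0, le_rfl, g x0, subset_convexHull ℝ _ ⟨x0, ⟨hx0, hx0v⟩, rfl⟩, by simp [hyv]⟩
    · have := hpos y hy hyv
      exact ⟨f (y - v), this.le, g y, subset_convexHull ℝ _ ⟨y, ⟨hy, hyv⟩, rfl⟩, by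
        simp only [hg]; rw [smul_smul]; field_simp; simp⟩
  have hcone' : ∀ x ∈ P, 0 ≤ f (x - v) ∧ ∃ y ∈ Q, x - v = f (x - v) • y := by
    intro x hx
    obtain ⟨t, ht, y, hy, hxy⟩ := hcone x hx
    have : f (x - v) = t := by rw [hxy, map_smul, hfQ y hy]; simp
    exact ⟨this ▸ ht, y, hy, this ▸ hxy⟩
  refine ⟨Q.extremePoints ℝ, ?_, ?_⟩
  · intro e he
    have heY : e ∈ Y := extremePoints_convexHull_subset he
    obtain ⟨x0, ⟨hx0, hx0v⟩, hx0e⟩ := heY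
    have hfe : f e = 1 := hfQ e he.1
    -- maximal T
    set A : Set ℝ := {t | 0 ≤ t ∧ v + t • e ∈ P} with hA
    have hAbd : BddAbove A := by
      obtain ⟨M, hM⟩ := (hPk.image (f.continuous)).bddAbove
      refine ⟨M - f v, ?_⟩
      rintro t ⟨-, ht⟩
      have := hM ⟨_, ht, rfl⟩
      simp [hfe] at this
      linarith
    have hAcl : IsClosed A := by
      have : A = Set.Ici 0 ∩ (fun t : ℝ => v + t • e) ⁻¹' P := by ext; simp [hA]
      rw [this]
      exact isClosed_Ici.inter (hPk.isClosed.preimage (by fun_prop))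
    have hx0A : f (x0 - v) ∈ A := by
      have := hpos x0 hx0 hx0v
      refine ⟨this.le, ?_⟩
      rw [← hx0e]; simp only [hg]; rw [smul_smul]
      rw [mul_one_div_cancel this.ne']; simpa using hXP hx0
    have hTA := hAcl.csSup_mem ⟨_, hx0A⟩ hAbd
    have hT0 : 0 < sSup A := (hpos x0 hx0 hx0v).trans_le (le_csSup hAbd hx0A)
    have hTm : ∀ t, 0 ≤ t → v + t • e ∈ P → t ≤ sSup A := fun t h1 h2 => le_csSup hAbd ⟨h1, h2⟩
    set T := sSup A with hT
    refine ⟨T, hT0, ?_, ?_, ?_⟩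
    · intro h
      have := congrArg f h
      simp [hfe] at this
      exact hT0.ne' this
    · exact hPc.segment_subset hv.1 hTA.2
    · have hseg : ∀ x, x ∈ P → ∀ t : ℝ, 0 ≤ t → x - v = t • e → x ∈ segment ℝ v (v + T • e) := by
        intro x hx t ht hxe
        have hx' : x = v + t • e := by rw [← hxe]; simp
        rw [hx'] at hx
        have := hTm t ht hx
        refine ⟨1 - t / T, t / T, ?_, by positivity, by ring, ?_⟩
        · rw [sub_nonneg, div_le_one hT0]; exact this
        · rw [hx']; ext k; simp; field_simp; ring
      intro x hx y hy z hz hzo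
      obtain ⟨p, q, hp, hq, hpq, hz2⟩ := hzo
      obtain ⟨p', q', hp', hq', hpq', hz'⟩ := hz
      have hze : z - v = (q' * T) • e := by
        have : p' = 1 - q' := by linarith
        rw [← hz', this]; ext k; simp; ring
      obtain ⟨fx, ex, hex, hxe⟩ := hcone' x hx
      obtain ⟨fy, ey, hey, hye⟩ := hcone' y hy
      rcases fx.eq_or_lt with h0 | h0
      · refine hseg x hx 0 le_rfl ?_
        rw [hxe, ← h0]; simp
      refine hseg x hx _ fx ?_
      have hsum : z - v = p • (x - v) + q • (y - v) := by
        rw [← hz2]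
        have : p = 1 - q := by linarith
        rw [this]; ext k; simp; ring
      have hfz : q' * T = p * f (x - v) + q * f (y - v) := by
        have := congrArg f (hze.symm.trans hsum)
        simpa only [map_smul, map_add, hfe, smul_eq_mul, mul_one] using this
      have hfz0 : 0 < q' * T := by
        rw [hfz]; have := mul_pos hp h0; have := mul_nonneg hq.le fy; linarith
      rcases fy.eq_or_lt with h1 | h1
      · have : ex = e := by
          have h3 : (p * f (x - v)) • ex = (q' * T) • e := by
            rw [← hze, hsum, mul_smul, ← hxe, hye, ← h1]; simp
          rw [hfz, ← h1, mul_zero, add_zero] at h3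
          exact smul_right_injective _ (mul_pos hp h0).ne' h3
        rw [← this]; exact hxe
      · have hop : e ∈ openSegment ℝ ex ey := by
          refine ⟨p * f (x - v) / (q' * T), q * f (y - v) / (q' * T), by positivity, by positivity, ?_, ?_⟩
          · rw [← add_div, ← hfz, div_self hfz0.ne']
          · have h3 : (p * f (x - v)) • ex + (q * f (y - v)) • ey = (q' * T) • e := by
              rw [← hze, hsum, mul_smul, mul_smul, ← hxe, ← hye]
            apply smul_right_injective _ hfz0.ne'
            simp only
            rw [← h3, smul_add, smul_smul, smul_smul, mul_div_cancel₀ _ hfz0.ne', mul_div_cancel₀ _ hfz0.ne']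
        have := he.2 hex hey hop
        rw [← this]; exact hxe
  · have hQ' : Q ⊆ convexHull ℝ (Q.extremePoints ℝ) := by
      have h1 := closure_convexHull_extremePoints (hYf.isCompact_convexHull ℝ) (convex_convexHull ℝ Y)
      have h2 : IsClosed (convexHull ℝ (Q.extremePoints ℝ)) :=
        (hYf.subset extremePoints_convexHull_subset).isClosed_convexHull ℝ
      rw [h2.closure_eq] at h1
      exact h1.ge
    intro x hx
    obtain ⟨t, ht, y, hy, h⟩ := hcone x hx
    exact ⟨t, ht, y, hQ' hy, h⟩

structure Corner (P : Set (Fin 3 → ℝ)) (v : Fin 3 → ℤ) (d : Fin 3 → Fin 3 → ℤ) : Prop where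
  det : det3 (d 0) (d 1) (d 2) = 1 ∨ det3 (d 0) (d 1) (d 2) = -1
  nb : ∀ i, toR3 (v + d i) ∈ P
  cone : ∀ x ∈ P, ∃ c : Fin 3 → ℝ, (∀ i, 0 ≤ c i) ∧ x = toR3 v + ∑ i, c i • toR3 (d i)

lemma edge_end_extreme {P : Set (Fin 3 → ℝ)} {v w : Fin 3 → ℝ} (h : IsEdge P v w) :
    w ∈ Set.extremePoints ℝ P := by
  obtain ⟨hne, hex⟩ := h
  refine ⟨hex.subset (right_mem_segment ℝ v w), ?_⟩
  intro x hx y hy hw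
  have h1 := hex.left_mem_of_mem_openSegment hx hy (right_mem_segment ℝ v w) hw
  have h2 := hex.right_mem_of_mem_openSegment hx hy (right_mem_segment ℝ v w) hw
  obtain ⟨a, b, ha, hb, hab, rfl⟩ := h1
  obtain ⟨c, d, hc, hd, hcd, rfl⟩ := h2
  obtain ⟨p, q, hp, hq, hpq, hw⟩ := hw
  have e1 : b = 1 - a := by linarith
  have e2 : d = 1 - c := by linarith
  have e3 : q = 1 - p := by linarith
  have : (p * a + q * c) • (v - w) = 0 := by
    have : p • (a • v + b • w) + q • (c • v + d • w) - w = (p * a + q * c) • (v - w) := by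
      rw [e1, e2, e3]; ext k; simp; ring
    rw [← this, hw, sub_self]
  rcases smul_eq_zero.1 this with h | h
  · have h3 := mul_nonneg hp.le ha
    have h4 := mul_nonneg hq.le hc
    have : p * a = 0 := by linarith
    have ha0 : a = 0 := by
      rcases mul_eq_zero.1 this with h | h
      · exact absurd h hp.ne'
      · exact h
    rw [e1, ha0]; simp
  · exact absurd (sub_eq_zero.1 h) hne

lemma primitive_mul {d m : Fin 3 → ℤ} (hd : IsPrimitive3 d) {t : ℝ} (ht : 0 < t)
    (h : toR3 m = t • toR3 d) : 1 ≤ t := by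
  have hb : ∃ x y z : ℤ, x * d 0 + y * d 1 + z * d 2 = 1 := by
    have h1 := Int.gcd_eq_gcd_ab (d 0) (Int.gcd (d 1) (d 2))
    have h2 := Int.gcd_eq_gcd_ab (d 1) (d 2)
    unfold IsPrimitive3 at hd
    rw [hd] at h1
    set A := Int.gcdA (d 0) (Int.gcd (d 1) (d 2))
    set B := Int.gcdB (d 0) (Int.gcd (d 1) (d 2))
    rw [h2] at h1
    push_cast at h1
    exact ⟨A, Int.gcdA (d 1) (d 2) * B, Int.gcdB (d 1) (d 2) * B, by rw [h1]; ring⟩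
  obtain ⟨x, y, z, hxyz⟩ := hb
  have hk : ∀ k, (m k : ℝ) = t * d k := fun k => by simpa [toR3] using congrFun h k
  have : t = ((x * m 0 + y * m 1 + z * m 2 : ℤ) : ℝ) := by
    push_cast
    rw [hk, hk, hk]
    have : (x * d 0 + y * d 1 + z * d 2 : ℝ) = 1 := by exact_mod_cast hxyz
    linear_combination (-t) * this
  rw [this] at ht ⊢
  have : 0 < x * m 0 + y * m 1 + z * m 2 := by exact_mod_cast ht
  exact_mod_cast this

lemma corner_exists {V : Finset (Fin 3 → ℤ)} {P : Set (Fin 3 → ℝ)}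
    (hP : P = convexHull ℝ (toR3 '' ↑V)) (hne : ∀ v, ∃ x ∈ toR3 '' (V : Set (Fin 3 → ℤ)), x ≠ v)
    (hs : IsSmooth P) {v : Fin 3 → ℝ} (hv : v ∈ Set.extremePoints ℝ P) :
    ∃ v' ∈ V, toR3 v' = v ∧ ∃ d, Corner P v' d := by
  have hVf : (toR3 '' (V : Set (Fin 3 → ℤ))).Finite := V.finite_toSet.image _
  have hPc : Convex ℝ P := hP ▸ convex_convexHull ℝ _
  have hext : ∀ w ∈ Set.extremePoints ℝ P, ∃ v' ∈ V, toR3 v' = w := by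
    intro w hw
    rw [hP] at hw
    have h := extremePoints_convexHull_subset hw
    exact h
  obtain ⟨v', hv'V, rfl⟩ := hext v hv
  refine ⟨v', hv'V, rfl, ?_⟩
  obtain ⟨w, -, hw, d, hd, hdet⟩ := hs _ hv
  rw [det3_eq] at hdet
  have hwe : ∀ i, IsEdge P (toR3 v') (w i) := by
    intro i
    have : w i ∈ {x | IsEdge P (toR3 v') x} := by rw [hw]; fin_cases i <;> simp
    exact this
  refine ⟨d, hdet, ?_, ?_⟩
  · intro i
    obtain ⟨hp, t, ht, htd⟩ := hd i
    obtain ⟨w', hw'V, hw'⟩ := hext _ (edge_end_extreme (hwe i))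
    have h1 : 1 ≤ t := primitive_mul (m := w' - v') hp ht (by rw [toR3_sub, hw', htd])
    have hwP : w i ∈ P := (edge_end_extreme (hwe i)).1
    have := conv2 hPc hv.1 hwP (s := 1 / t) (by positivity) (by rw [div_le_one ht]; exact h1)
    convert this using 1
    have hwi : w i = toR3 v' + t • toR3 (d i) := by rw [← htd]; simp
    rw [hwi, toR3_add]; ext k; simp; field_simp; ring
  · obtain ⟨D, hD1, hD2⟩ := edge_dirs hVf hP hv (hne _)
    set K : Set (Fin 3 → ℝ) := {y | ∃ c : Fin 3 → ℝ, (∀ i, 0 ≤ c i) ∧ y = ∑ i, c i • toR3 (d i)} with hK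
    have hKc : Convex ℝ K := by
      rintro _ ⟨a, ha, rfl⟩ _ ⟨b, hb, rfl⟩ p q hp hq hpq
      refine ⟨fun i => p * a i + q * b i, fun i => add_nonneg (mul_nonneg hp (ha i)) (mul_nonneg hq (hb i)), ?_⟩
      ext k; simp [Fin.sum_univ_three]; ring
    have hDK : convexHull ℝ D ⊆ K := by
      refine convexHull_min ?_ hKc
      intro e he
      obtain ⟨T, hT, hedge⟩ := hD1 e he
      have : toR3 v' + T • e ∈ {x | IsEdge P (toR3 v') x} := hedge
      rw [hw] at this
      have : ∃ i, toR3 v' + T • e = w i := by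
        rcases this with h | h | h
        · exact ⟨0, h⟩
        · exact ⟨1, h⟩
        · exact ⟨2, h⟩
      obtain ⟨i, hi⟩ := this
      obtain ⟨-, t, ht, htd⟩ := hd i
      have hTe : T • e = t • toR3 (d i) := by rw [← htd, ← hi]; simp
      refine ⟨fun j => if j = i then t / T else 0, fun j => by simp only; split_ifs <;> positivity, ?_⟩
      simp only [ite_smul, zero_smul, Finset.sum_ite_eq', Finset.mem_univ, if_true]
      apply smul_right_injective _ hT.ne'
      simp only
      rw [hTe, smul_smul, mul_div_cancel₀ _ hT.ne']
    intro x hx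
    obtain ⟨t, ht, y, hy, h⟩ := hD2 x hx
    obtain ⟨c, hc, rfl⟩ := hDK hy
    refine ⟨fun i => t * c i, fun i => mul_nonneg ht (hc i), ?_⟩
    rw [sub_eq_iff_eq_add] at h
    rw [h]; simp only [Finset.smul_sum, mul_smul]; abel


def CornerAt (S : ℤ → ℤ → ℤ → Prop) (p0 p1 p2 : ℤ) : Prop :=
  ∃ e0 e1 e2 g0 g1 g2 : ℤ, S (p0 + e0) (p1 + e1) (p2 + e2) ∧ S (p0 + g0) (p1 + g1) (p2 + g2) ∧
    (e1 * g2 - e2 * g1 = 1 ∨ e1 * g2 - e2 * g1 = -1) ∧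
    ∀ a b c, S a b c → ∃ m n : ℤ, 0 ≤ m ∧ 0 ≤ n ∧ a = p0 + m * e0 + n * g0 ∧
      b = p1 + m * e1 + n * g1 ∧ c = p2 + m * e2 + n * g2

structure Good (S : ℤ → ℤ → ℤ → Prop) : Prop where
  sum : ∀ a b c, S a b c → a + b + c = 1
  e0 : S 1 0 0
  e1 : S 0 1 0
  e2 : S 0 0 1
  n0 : ¬ S (-1) 1 1
  n1 : ¬ S 1 (-1) 1
  n2 : ¬ S 1 1 (-1)
  conv : ∀ p0 p1 p2 q0 q1 q2 x y s0 s1 s2 r0 r1 r2 : ℤ, S p0 p1 p2 → S q0 q1 q2 →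
    0 ≤ x → 0 ≤ y → 0 ≤ s0 → 0 ≤ s1 → 0 ≤ s2 → 0 < x + y + s0 + s1 + s2 →
    (x + y + s0 + s1 + s2) * r0 = x * p0 + y * q0 + s0 →
    (x + y + s0 + s1 + s2) * r1 = x * p1 + y * q1 + s1 →
    (x + y + s0 + s1 + s2) * r2 = x * p2 + y * q2 + s2 → S r0 r1 r2
  cor0 : ∃ a b c, S a b c ∧ 1 ≤ a ∧ CornerAt S a b c
  cor1 : ∃ a b c, S a b c ∧ 1 ≤ b ∧ CornerAt S a b c
  cor2 : ∃ a b c, S a b c ∧ 1 ≤ c ∧ CornerAt S a b c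

lemma CornerAt.rot {S : ℤ → ℤ → ℤ → Prop} (hs : ∀ a b c, S a b c → a + b + c = 1) {a b c : ℤ}
    (h0 : S a b c)
    (h : CornerAt S a b c) : CornerAt (fun a b c => S b c a) c a b := by
  obtain ⟨e0, e1, e2, g0, g1, g2, h1, h2, h3, h4⟩ := h
  refine ⟨e2, e0, e1, g2, g0, g1, h1, h2, ?_, ?_⟩
  · have k0 := hs _ _ _ h0
    have k1 := hs _ _ _ h1
    have k2 := hs _ _ _ h2
    have r1 : e0 = -e1 - e2 := by linarith
    have r2 : g0 = -g1 - g2 := by linarith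
    have : e0 * g1 - e1 * g0 = e1 * g2 - e2 * g1 := by rw [r1, r2]; ring
    rw [this]; exact h3
  · intro a' b' c' h
    obtain ⟨m, n, hm, hn, i1, i2, i3⟩ := h4 _ _ _ h
    exact ⟨m, n, hm, hn, i3, i1, i2⟩

lemma CornerAt.swap {S : ℤ → ℤ → ℤ → Prop} {a b c : ℤ}
    (h : CornerAt S a b c) : CornerAt (fun a b c => S a c b) a c b := by
  obtain ⟨e0, e1, e2, g0, g1, g2, h1, h2, h3, h4⟩ := h
  refine ⟨g0, g2, g1, e0, e2, e1, h2, h1, ?_, ?_⟩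
  · have : g2 * e1 - g1 * e2 = e1 * g2 - e2 * g1 := by ring
    rw [this]; exact h3
  · intro a' b' c' h
    obtain ⟨m, n, hm, hn, i1, i2, i3⟩ := h4 _ _ _ h
    exact ⟨n, m, hn, hm, by linarith, by linarith, by linarith⟩

lemma Good.rot {S : ℤ → ℤ → ℤ → Prop} (h : Good S) : Good (fun a b c => S b c a) where
  sum := fun a b c hs => by have := h.sum _ _ _ hs; linarith
  e0 := h.e2
  e1 := h.e0
  e2 := h.e1
  n0 := h.n2
  n1 := h.n0
  n2 := h.n1
  conv := by
    intro p0 p1 p2 q0 q1 q2 x y s0 s1 s2 r0 r1 r2 hp hq hx hy h0 h1 h2 hN i0 i1 i2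
    have e : x + y + s1 + s2 + s0 = x + y + s0 + s1 + s2 := by ring
    exact h.conv p1 p2 p0 q1 q2 q0 x y s1 s2 s0 r1 r2 r0 hp hq hx hy h1 h2 h0 (e ▸ hN) (e ▸ i1) (e ▸ i2) (e ▸ i0)
  cor0 := by
    obtain ⟨a, b, c, hs, h1, h2⟩ := h.cor2
    exact ⟨c, a, b, hs, h1, h2.rot h.sum hs⟩
  cor1 := by
    obtain ⟨a, b, c, hs, h1, h2⟩ := h.cor0
    exact ⟨c, a, b, hs, h1, h2.rot h.sum hs⟩
  cor2 := by
    obtain ⟨a, b, c, hs, h1, h2⟩ := h.cor1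
    exact ⟨c, a, b, hs, h1, h2.rot h.sum hs⟩

lemma Good.swap {S : ℤ → ℤ → ℤ → Prop} (h : Good S) : Good (fun a b c => S a c b) where
  sum := fun a b c hs => by have := h.sum _ _ _ hs; linarith
  e0 := h.e0
  e1 := h.e2
  e2 := h.e1
  n0 := h.n0
  n1 := h.n2
  n2 := h.n1
  conv := by
    intro p0 p1 p2 q0 q1 q2 x y s0 s1 s2 r0 r1 r2 hp hq hx hy h0 h1 h2 hN i0 i1 i2
    have e : x + y + s0 + s2 + s1 = x + y + s0 + s1 + s2 := by ring
    exact h.conv p0 p2 p1 q0 q2 q1 x y s0 s2 s1 r0 r2 r1 hp hq hx hy h0 h2 h1 (e ▸ hN) (e ▸ i0) (e ▸ i2) (e ▸ i1)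
  cor0 := by
    obtain ⟨a, b, c, hs, h1, h2⟩ := h.cor0
    exact ⟨a, c, b, hs, h1, h2.swap⟩
  cor1 := by
    obtain ⟨a, b, c, hs, h1, h2⟩ := h.cor2
    exact ⟨a, c, b, hs, h1, h2.swap⟩
  cor2 := by
    obtain ⟨a, b, c, hs, h1, h2⟩ := h.cor1
    exact ⟨a, c, b, hs, h1, h2.swap⟩

lemma Good.two {S : ℤ → ℤ → ℤ → Prop} (h : Good S) {a b c : ℤ} (hs : S a b c) (hb : 1 ≤ b) (hc : 1 ≤ c) :
    False := by
  have := h.sum _ _ _ hs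
  refine h.n0 (h.conv a b c a b c 1 0 0 (-a - b) (-a - c) _ _ _ hs hs ?_ ?_ ?_ ?_ ?_ ?_ ?_ ?_ ?_) <;> nlinarith

lemma Good.H2 {S : ℤ → ℤ → ℤ → Prop} (h : Good S) {a b c : ℤ} (hs : S a b c) :
    (1 ≤ a ∧ b ≤ 0 ∧ c ≤ 0) ∨ (a ≤ 0 ∧ 1 ≤ b ∧ c ≤ 0) ∨ (a ≤ 0 ∧ b ≤ 0 ∧ 1 ≤ c) := by
  have h0 := h.sum _ _ _ hs
  have h1 : ¬ (1 ≤ b ∧ 1 ≤ c) := fun k => h.two hs k.1 k.2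
  have h2 : ¬ (1 ≤ a ∧ 1 ≤ b) := fun k => h.rot.two (a := c) (b := a) (c := b) hs k.1 k.2
  have h3 : ¬ (1 ≤ c ∧ 1 ≤ a) := fun k => h.rot.rot.two (a := b) (b := c) (c := a) hs k.1 k.2
  omega

lemma Good.H3 {S : ℤ → ℤ → ℤ → Prop} (h : Good S) :
    (∀ a b c, S a b c → 1 ≤ b → a = 0) ∨ (∀ a b c, S a b c → 1 ≤ c → a = 0) := by
  by_contra hcon
  push Not at hcon
  obtain ⟨⟨p0, p1, p2, hp, hp1, hp0⟩, q0, q1, q2, hq, hq2, hq0⟩ := hcon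
  have sp := h.sum _ _ _ hp
  have sq := h.sum _ _ _ hq
  have bp : p0 ≤ -1 ∧ p2 ≤ 0 := by have := h.H2 hp; omega
  have bq : q0 ≤ -1 ∧ q1 ≤ 0 := by have := h.H2 hq; omega
  obtain ⟨α, rfl⟩ : ∃ α, p0 = -α := ⟨-p0, by ring⟩
  obtain ⟨γ, rfl⟩ : ∃ γ, p2 = -γ := ⟨-p2, by ring⟩
  obtain ⟨α', rfl⟩ : ∃ α, q0 = -α := ⟨-q0, by ring⟩
  obtain ⟨β', rfl⟩ : ∃ α, q1 = -α := ⟨-q1, by ring⟩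
  obtain rfl : p1 = 1 + α + γ := by linarith
  obtain rfl : q2 = 1 + α' + β' := by linarith
  have a1 : 0 ≤ α - 1 := by linarith
  have a2 : 0 ≤ α' - 1 := by linarith
  have a3 : 0 ≤ γ := by linarith
  have a4 : 0 ≤ β' := by linarith
  refine h.n0 (h.conv _ _ _ _ _ _ (α' + β') (1 + γ) 0 0 ((α' + β') * (α + γ) - (1 + γ) * (1 + β')) _ _ _ hp hq
    ?_ ?_ ?_ ?_ ?_ ?_ ?_ ?_ ?_)
  · linarith
  · linarith
  · rfl
  · rfl
  · nlinarith [mul_nonneg a1 a2, mul_nonneg a1 a4, mul_nonneg a3 a2]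
  · nlinarith [mul_nonneg a1 a2, mul_nonneg a1 a4, mul_nonneg a3 a2]
  · ring
  · ring
  · ring

lemma Good.L1 {S : ℤ → ℤ → ℤ → Prop} (h : Good S) (h1 : ∀ a b c, S a b c → 1 ≤ a → b = 0)
    (h2 : ∀ a b c, S a b c → 1 ≤ a → c = 0) : ∀ a b c, S a b c → 0 ≤ b ∧ 0 ≤ c := by
  obtain ⟨p0, p1, p2, hp, hp0, e0, e1, e2, g0, g1, g2, he, hg, hdet, hall⟩ := h.cor0
  have hp1 : p1 = 0 := h1 _ _ _ hp hp0
  have hp2 : p2 = 0 := h2 _ _ _ hp hp0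
  have hps := h.sum _ _ _ hp
  have hp0' : p0 = 1 := by linarith
  subst hp1 hp2 hp0'
  have es := h.sum _ _ _ he
  have gs := h.sum _ _ _ hg
  obtain ⟨m, n, hm, hn, k0, k1, k2⟩ := hall _ _ _ h.e2
  obtain ⟨m', n', hm', hn', l0, l1, l2⟩ := hall _ _ _ h.e1
  have he0 : ¬ 1 ≤ 1 + e0 := by
    intro hh
    have i1 := h1 _ _ _ he hh
    have i2 := h2 _ _ _ he hh
    have i1 : e1 = 0 := by linarith
    have i2 : e2 = 0 := by linarith
    subst i1 i2
    simp at hdet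
  have hg0 : ¬ 1 ≤ 1 + g0 := by
    intro hh
    have i1 := h1 _ _ _ hg hh
    have i2 := h2 _ _ _ hg hh
    have i1 : g1 = 0 := by linarith
    have i2 : g2 = 0 := by linarith
    subst i1 i2
    simp at hdet
  have key : ∀ e1 e2 g1 g2 : ℤ, e2 ≤ 0 → g1 ≤ 0 → 1 - e2 ≤ e1 → 1 - g1 ≤ g2 →
      (e1 * g2 - e2 * g1 = 1 ∨ e1 * g2 - e2 * g1 = -1) → e2 = 0 ∧ g1 = 0 ∧ e1 = 1 ∧ g2 = 1 := by
    intro e1 e2 g1 g2 i1 i2 i3 i4 i5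
    have := mul_nonneg (sub_nonneg.2 i3) (show 0 ≤ g2 by linarith)
    have := mul_nonneg (sub_nonneg.2 i4) (show 0 ≤ 1 - e2 by linarith)
    have j1 : e2 = 0 := by rcases i5 with i5 | i5 <;> nlinarith
    have j2 : g1 = 0 := by rcases i5 with i5 | i5 <;> nlinarith
    subst j1 j2
    refine ⟨rfl, rfl, ?_, ?_⟩ <;> rcases i5 with i5 | i5 <;> nlinarith
  rcases h.H2 he with A | A | A
  · exact absurd A.1 he0
  · rcases h.H2 hg with B | B | B
    · exact absurd B.1 hg0
    · exfalso; nlinarith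
    · obtain ⟨j1, j2, j3, j4⟩ := key e1 e2 g1 g2 (by linarith) (by linarith) (by linarith) (by linarith) hdet
      subst j1 j2 j3 j4
      intro a b c hs
      obtain ⟨m, n, hm, hn, k0, k1, k2⟩ := hall _ _ _ hs
      constructor <;> linarith
  · rcases h.H2 hg with B | B | B
    · exact absurd B.1 hg0
    · obtain ⟨j1, j2, j3, j4⟩ := key g1 g2 e1 e2 (by linarith) (by linarith) (by linarith) (by linarith)
        (by rcases hdet with hdet | hdet
            · right; linarith
            · left; linarith)
      subst j1 j2 j3 j4
      intro a b c hs
      obtain ⟨m, n, hm, hn, k0, k1, k2⟩ := hall _ _ _ hs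
      constructor <;> linarith
    · exfalso; nlinarith

lemma Good.L2 {S : ℤ → ℤ → ℤ → Prop} (h : Good S) (h1 : ∀ a b c, S a b c → 1 ≤ a → b = 0)
    (h2 : ∀ a b c, S a b c → 1 ≤ a → c = 0) : ∀ a b c, S a b c → 0 ≤ a ∧ 0 ≤ b ∧ 0 ≤ c := by
  have k := h.L1 h1 h2
  rcases h.H3 with h3 | h3
  · have := h.rot.rot.L1 (fun b c a hs hb => by
      have := h.H2 hs; have := k _ _ _ hs; omega) (fun b c a hs hb => h3 _ _ _ hs hb)
    intro a b c hs
    exact ⟨(this b c a hs).2, k _ _ _ hs⟩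
  · have := h.rot.L1 (fun c a b hs hb => h3 _ _ _ hs hb) (fun c a b hs hb => by
      have := h.H2 hs; have := k _ _ _ hs; omega)
    intro a b c hs
    exact ⟨(this c a b hs).1, k _ _ _ hs⟩

lemma Good.pinwheel {S : ℤ → ℤ → ℤ → Prop} (h : Good S) (hA : ∀ a b c, S a b c → 1 ≤ b → a = 0)
    (hB : ∀ a b c, S a b c → 1 ≤ c → b = 0) (hC : ∀ a b c, S a b c → 1 ≤ a → c = 0) :
    ∀ a b c, S a b c → 0 ≤ a ∧ 0 ≤ b ∧ 0 ≤ c := by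
  have fin : (∀ a b c, S a b c → 0 ≤ c) → ∀ a b c, S a b c → 0 ≤ a ∧ 0 ≤ b ∧ 0 ≤ c := by
    intro h0
    have := h.rot.rot.L2 (fun b c a hs hb => by
      have := h.H2 hs; have := h0 _ _ _ hs; omega) (fun b c a hs hb => hA _ _ _ hs hb)
    intro a b c hs
    have := this b c a hs
    tauto
  apply fin
  obtain ⟨p0, p1, p2, hp, hp0, e0, e1, e2, g0, g1, g2, he, hg, hdet, hall⟩ := h.cor0
  have hps := h.sum _ _ _ hp
  have hp2 : p2 = 0 := hC _ _ _ hp hp0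
  subst hp2
  have es := h.sum _ _ _ he
  have gs := h.sum _ _ _ hg
  have e2c : ∀ a b c, S a b c → 1 ≤ a ∧ c = 0 ∧ b ≤ 0 ∨ a = 0 ∧ 1 ≤ b ∧ c ≤ 0 ∨ b = 0 ∧ 1 ≤ c ∧ a ≤ 0 := by
    intro a b c hs
    have := h.H2 hs
    have := hA _ _ _ hs
    have := hB _ _ _ hs
    have := hC _ _ _ hs
    omega
  obtain ⟨m, n, hm, hn, k0, k1, k2⟩ := hall _ _ _ h.e2
  obtain ⟨m', n', hm', hn', l0, l1, l2⟩ := hall _ _ _ h.e1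
  have key : ∀ p1 e1 e2 g1 g2 : ℤ, p1 ≤ 0 → e2 ≤ 0 → p1 + e1 + e2 = 1 → g1 = - p1 → 1 ≤ g2 →
      (e1 * g2 - e2 * g1 = 1 ∨ e1 * g2 - e2 * g1 = -1) → e2 = 0 := by
    intro p1 e1 e2 g1 g2 i1 i2 i3 i4 i5 i6
    subst i4
    obtain rfl : e1 = 1 - p1 - e2 := by linarith
    have := mul_nonneg (show 0 ≤ 1 - p1 - e2 by linarith) (sub_nonneg.2 i5)
    have := mul_nonneg_of_nonpos_of_nonpos i1 i2
    rcases i6 with i6 | i6 <;> nlinarith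
  have fin2 : 0 ≤ e2 → 0 ≤ g2 → ∀ a b c, S a b c → 0 ≤ c := by
    intro h1 h2 a b c hs
    obtain ⟨m, n, hm, hn, k0, k1, k2⟩ := hall _ _ _ hs
    rw [k2]
    have := mul_nonneg hm h1
    have := mul_nonneg hn h2
    linarith
  have hp1 := e2c _ _ _ hp
  rcases e2c _ _ _ he with A | A | A <;> rcases e2c _ _ _ hg with B | B | B
  · exfalso; nlinarith
  · exfalso; nlinarith
  · exact fin2 (by linarith) (by linarith)
  · exfalso; nlinarith
  · exfalso; nlinarith
  · have := key p1 e1 e2 g1 g2 (by omega) (by linarith) (by linarith) (by linarith) (by linarith) hdet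
    exact fin2 (by linarith) (by linarith)
  · exact fin2 (by linarith) (by linarith)
  · have := key p1 g1 g2 e1 e2 (by omega) (by linarith) (by linarith) (by linarith) (by linarith)
      (by rcases hdet with hdet | hdet
          · right; linarith
          · left; linarith)
    exact fin2 (by linarith) (by linarith)
  · exfalso
    have : m' = 0 := by nlinarith
    have : n' = 0 := by nlinarith
    subst_vars
    linarith

lemma Good.main {S : ℤ → ℤ → ℤ → Prop} (h : Good S) :
    ∀ a b c, S a b c → 0 ≤ a ∧ 0 ≤ b ∧ 0 ≤ c := by
  have hA : (∀ a b c, S a b c → 1 ≤ b → a = 0) ∨ (∀ a b c, S a b c → 1 ≤ c → a = 0) := h.H3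
  have hB : (∀ a b c, S a b c → 1 ≤ c → b = 0) ∨ (∀ a b c, S a b c → 1 ≤ a → b = 0) := by
    rcases h.rot.rot.H3 with k | k
    · left; exact fun a b c hs => k b c a hs
    · right; exact fun a b c hs => k b c a hs
  have hC : (∀ a b c, S a b c → 1 ≤ a → c = 0) ∨ (∀ a b c, S a b c → 1 ≤ b → c = 0) := by
    rcases h.rot.H3 with k | k
    · left; exact fun a b c hs => k c a b hs
    · right; exact fun a b c hs => k c a b hs
  have s1 : (∀ a b c, S a b c → 1 ≤ b → a = 0) → (∀ a b c, S a b c → 1 ≤ b → c = 0) →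
      ∀ a b c, S a b c → 0 ≤ a ∧ 0 ≤ b ∧ 0 ≤ c := by
    intro k1 k2 a b c hs
    have := h.rot.rot.L2 (fun b c a hs => k2 a b c hs) (fun b c a hs => k1 a b c hs) b c a hs
    tauto
  have s2 : (∀ a b c, S a b c → 1 ≤ c → a = 0) → (∀ a b c, S a b c → 1 ≤ c → b = 0) →
      ∀ a b c, S a b c → 0 ≤ a ∧ 0 ≤ b ∧ 0 ≤ c := by
    intro k1 k2 a b c hs
    have := h.rot.L2 (fun c a b hs => k1 a b c hs) (fun c a b hs => k2 a b c hs) c a b hs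
    tauto
  rcases hA with hA | hA <;> rcases hB with hB | hB <;> rcases hC with hC | hC
  · exact h.pinwheel hA hB hC
  · exact s1 hA hC
  · exact h.L2 hB hC
  · exact s1 hA hC
  · exact s2 hA hB
  · exact s2 hA hB
  · exact h.L2 hB hC
  · intro a b c hs
    have := h.swap.pinwheel (fun a c b hs => hA a b c hs) (fun a c b hs => hC a b c hs)
      (fun a c b hs => hB a b c hs) a c b hs
    tauto


lemma Corner.swap01 {P : Set (Fin 3 → ℝ)} {v : Fin 3 → ℤ} {d : Fin 3 → Fin 3 → ℤ} (h : Corner P v d) :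
    Corner P v ![d 1, d 0, d 2] where
  det := by
    have : det3 (d 1) (d 0) (d 2) = - det3 (d 0) (d 1) (d 2) := by simp [det3]; ring
    simp only [Matrix.cons_val]
    rw [this]; rcases h.det with k | k <;> rw [k] <;> simp
  nb := fun i => by fin_cases i <;> exact h.nb _
  cone := by
    intro x hx
    obtain ⟨c, hc, rfl⟩ := h.cone x hx
    refine ⟨![c 1, c 0, c 2], fun i => by fin_cases i <;> exact hc _, ?_⟩
    simp [Fin.sum_univ_three]; abel

lemma Corner.swap12 {P : Set (Fin 3 → ℝ)} {v : Fin 3 → ℤ} {d : Fin 3 → Fin 3 → ℤ} (h : Corner P v d) :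
    Corner P v ![d 0, d 2, d 1] where
  det := by
    have : det3 (d 0) (d 2) (d 1) = - det3 (d 0) (d 1) (d 2) := by simp [det3]; ring
    simp only [Matrix.cons_val]
    rw [this]; rcases h.det with k | k <;> rw [k] <;> simp
  nb := fun i => by fin_cases i <;> exact h.nb _
  cone := by
    intro x hx
    obtain ⟨c, hc, rfl⟩ := h.cone x hx
    refine ⟨![c 0, c 2, c 1], fun i => by fin_cases i <;> exact hc _, ?_⟩
    simp [Fin.sum_univ_three]; abel

lemma unimod_span {d0 d1 d2 : Fin 3 → ℤ} (h : det3 d0 d1 d2 = 1 ∨ det3 d0 d1 d2 = -1) (m : Fin 3 → ℤ) :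
    ∃ n0 n1 n2 : ℤ, m = n0 • d0 + n1 • d1 + n2 • d2 := by
  refine ⟨det3 d0 d1 d2 * det3 m d1 d2, det3 d0 d1 d2 * det3 d0 m d2, det3 d0 d1 d2 * det3 d0 d1 m, ?_⟩
  have h2 : det3 d0 d1 d2 * det3 d0 d1 d2 = 1 := by rcases h with h | h <;> rw [h] <;> norm_num
  have key : ∀ k, det3 d0 d1 d2 * m k = det3 m d1 d2 * d0 k + det3 d0 m d2 * d1 k + det3 d0 d1 m * d2 k := by
    intro k; fin_cases k <;> simp [det3] <;> ring
  ext k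
  simp only [Pi.add_apply, Pi.smul_apply, smul_eq_mul]
  linear_combination (-m k) * h2 + det3 d0 d1 d2 * key k

lemma indep3 {d0 d1 d2 : Fin 3 → ℝ} (h : det3 d0 d1 d2 ≠ 0) {a b c a' b' c' : ℝ}
    (he : a • d0 + b • d1 + c • d2 = a' • d0 + b' • d1 + c' • d2) : a = a' ∧ b = b' ∧ c = c' := by
  have hk : ∀ k, a * d0 k + b * d1 k + c * d2 k = a' * d0 k + b' * d1 k + c' * d2 k := fun k => by
    simpa using congrFun he k
  have h0 := hk 0
  have h1 := hk 1
  have h2 := hk 2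
  refine ⟨?_, ?_, ?_⟩ <;> rw [← sub_eq_zero] <;> apply (mul_eq_zero.1 _).resolve_right h <;>
    simp only [det3]
  · linear_combination (d1 1 * d2 2 - d1 2 * d2 1) * h0 - (d1 0 * d2 2 - d1 2 * d2 0) * h1 + (d1 0 * d2 1 - d1 1 * d2 0) * h2
  · linear_combination (- (d0 1 * d2 2 - d0 2 * d2 1)) * h0 + (d0 0 * d2 2 - d0 2 * d2 0) * h1 - (d0 0 * d2 1 - d0 1 * d2 0) * h2
  · linear_combination (d0 1 * d1 2 - d0 2 * d1 1) * h0 - (d0 0 * d1 2 - d0 2 * d1 0) * h1 + (d0 0 * d1 1 - d0 1 * d1 0) * h2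

lemma Corner.detR {P : Set (Fin 3 → ℝ)} {v : Fin 3 → ℤ} {d : Fin 3 → Fin 3 → ℤ} (h : Corner P v d) :
    det3 (toR3 (d 0)) (toR3 (d 1)) (toR3 (d 2)) ≠ 0 := by
  rw [det3_toR3]
  rcases h.det with k | k <;> rw [k] <;> norm_num

lemma Corner.int {P : Set (Fin 3 → ℝ)} {v : Fin 3 → ℤ} {d : Fin 3 → Fin 3 → ℤ} (h : Corner P v d)
    {m : Fin 3 → ℤ} (hm : toR3 m ∈ P) :
    ∃ n0 n1 n2 : ℤ, 0 ≤ n0 ∧ 0 ≤ n1 ∧ 0 ≤ n2 ∧ m = v + n0 • d 0 + n1 • d 1 + n2 • d 2 := by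
  obtain ⟨n0, n1, n2, hn⟩ := unimod_span h.det (m - v)
  obtain ⟨c, hc, hx⟩ := h.cone _ hm
  have : (n0 : ℝ) • toR3 (d 0) + (n1 : ℝ) • toR3 (d 1) + (n2 : ℝ) • toR3 (d 2) =
      c 0 • toR3 (d 0) + c 1 • toR3 (d 1) + c 2 • toR3 (d 2) := by
    have e := congrArg toR3 hn
    rw [toR3_sub, toR3_add, toR3_add, toR3_smul, toR3_smul, toR3_smul, hx] at e
    rw [← e, Fin.sum_univ_three]; abel
  obtain ⟨e0, e1, e2⟩ := indep3 h.detR this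
  refine ⟨n0, n1, n2, ?_, ?_, ?_, ?_⟩
  · have := hc 0; rw [← e0] at this; exact_mod_cast this
  · have := hc 1; rw [← e1] at this; exact_mod_cast this
  · have := hc 2; rw [← e2] at this; exact_mod_cast this
  · rw [sub_eq_iff_eq_add] at hn; rw [hn]; abel

lemma corner_face {P : Set (Fin 3 → ℝ)} {v : Fin 3 → ℤ} {d : Fin 3 → Fin 3 → ℤ} (h : Corner P v d)
    (f : (Fin 3 → ℝ) →ₗ[ℝ] ℝ) (M : ℝ) (hM : ∀ x ∈ P, f x ≤ M) (hv : f (toR3 v) = M)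
    (hy : ∃ y ∈ P, f y < M) (u w z : Fin 3 → ℝ) (hu : toR3 v + u ∈ P) (hw : toR3 v + w ∈ P)
    (fu : f u = 0) (fw : f w = 0) (hi : det3 u w z ≠ 0) :
    ∃ d', Corner P v d' ∧ f (toR3 (d' 0)) = 0 ∧ f (toR3 (d' 1)) = 0 ∧ f (toR3 (d' 2)) < 0 := by
  have hd : ∀ i, f (toR3 (d i)) ≤ 0 := by
    intro i
    have := hM _ (h.nb i)
    rw [toR3_add, map_add, hv] at this
    linarith
  have hp : ∀ u, toR3 v + u ∈ P → f u = 0 → ∃ c : Fin 3 → ℝ, (∀ i, f (toR3 (d i)) < 0 → c i = 0) ∧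
      ∀ k, u k = c 0 * toR3 (d 0) k + c 1 * toR3 (d 1) k + c 2 * toR3 (d 2) k := by
    intro u hu fu
    obtain ⟨c, hc, hx⟩ := h.cone _ hu
    have hx := add_left_cancel hx
    refine ⟨c, ?_, fun k => by rw [hx]; simp [Fin.sum_univ_three]⟩
    have hs : ∑ i, c i * f (toR3 (d i)) = 0 := by
      rw [← fu, hx]; simp
    have := (Finset.sum_eq_zero_iff_of_nonpos (fun i _ => mul_nonpos_of_nonneg_of_nonpos (hc i) (hd i))).1 hs
    intro i hi
    rcases mul_eq_zero.1 (this i (Finset.mem_univ _)) with h | h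
    · exact h
    · exact absurd h hi.ne
  obtain ⟨c, hc, hcu⟩ := hp u hu fu
  obtain ⟨e, he, hew⟩ := hp w hw fw
  have hdeg : ∀ i j, i ≠ j → f (toR3 (d i)) < 0 → f (toR3 (d j)) < 0 → False := by
    intro i j hij h1 h2
    apply hi
    have c1 := hc i h1
    have c2 := hc j h2
    have e1 := he i h1
    have e2 := he j h2
    simp only [det3, hcu, hew]
    fin_cases i <;> fin_cases j <;> simp at hij c1 c2 e1 e2 <;> rw [c1, c2, e1, e2] <;> ring
  rcases (hd 0).eq_or_lt with h0 | h0 <;> rcases (hd 1).eq_or_lt with h1 | h1 <;>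
    rcases (hd 2).eq_or_lt with h2 | h2
  · exfalso
    obtain ⟨y, hy, hlt⟩ := hy
    obtain ⟨c, hc, rfl⟩ := h.cone _ hy
    simp [Fin.sum_univ_three, h0, h1, h2, hv] at hlt
  · exact ⟨d, h, h0, h1, h2⟩
  · exact ⟨_, h.swap12, h0, h2, h1⟩
  · exact (hdeg 1 2 (by decide) h1 h2).elim
  · exact ⟨_, h.swap01.swap12, h1, h2, h0⟩
  · exact (hdeg 0 2 (by decide) h0 h2).elim
  · exact (hdeg 0 1 (by decide) h0 h1).elim
  · exact (hdeg 0 1 (by decide) h0 h1).elim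

structure Setup (P : Set (Fin 3 → ℝ)) (C : Fin 3 → ℤ) (f : (Fin 3 → ℝ) →ₗ[ℝ] ℝ) (M : ℝ)
    (a u w : Fin 3 → ℤ) : Prop where
  conv : Convex ℝ P
  comp : IsCompact P
  sym : ∀ x ∈ P, toR3 C - x ∈ P
  cor : ∀ v ∈ Set.extremePoints ℝ P, ∃ v', toR3 v' = v ∧ ∃ d, Corner P v' d
  fle : ∀ x ∈ P, f x ≤ M
  fa : f (toR3 a) = M
  fu : f (toR3 u) = 0
  fw : f (toR3 w) = 0
  fC : f (toR3 C) < 2 * M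
  ha : toR3 a ∈ P
  hu : toR3 (a + u) ∈ P
  hw : toR3 (a + w) ∈ P
  ind : det3 u w (C - 2 • a) ≠ 0
  lat : ∀ m : Fin 3 → ℤ, f (toR3 m) = M → ∃ b c : ℤ, m = a + b • u + c • w

lemma Setup.flt {P C f M a u w} (h : Setup P C f M a u w) : ∃ y ∈ P, f y < M :=
  ⟨_, h.sym _ h.ha, by rw [map_sub, h.fa]; linarith [h.fC]⟩

lemma Setup.indR {P C f M a u w} (h : Setup P C f M a u w) :
    det3 (toR3 u) (toR3 w) (toR3 (C - 2 • a)) ≠ 0 := by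
  rw [det3_toR3]; exact_mod_cast h.ind

lemma Setup.uniq {P C f M a u w} (h : Setup P C f M a u w) {b c b' c' : ℤ}
    (he : b • u + c • w = b' • u + c' • w) : b = b' ∧ c = c' := by
  have := congrArg toR3 he
  simp only [toR3_add, toR3_smul] at this
  have := indep3 h.indR (a := b) (b := c) (c := 0) (a' := b') (b' := c') (c' := 0) (by simpa using this)
  exact ⟨by exact_mod_cast this.1, by exact_mod_cast this.2.1⟩

lemma Setup.fval {P C f M a u w} (h : Setup P C f M a u w) (b c : ℤ) : f (toR3 (a + b • u + c • w)) = M := by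
  simp [-zsmul_eq_mul, toR3_add, toR3_smul, h.fa, h.fu, h.fw]

/-- a functional positive at a facet point is positive at an extreme point of the facet -/
lemma Setup.ext {P C f M a u w} (h : Setup P C f M a u w) (φ : (Fin 3 → ℝ) →ₗ[ℝ] ℝ) (K : ℝ)
    (x : Fin 3 → ℝ) (hx : x ∈ P) (hfx : f x = M) (hφ : K < φ x) :
    ∃ v ∈ Set.extremePoints ℝ P, f v = M ∧ K < φ v := by
  have fc : Continuous f := f.continuous_of_finiteDimensional
  have φc : Continuous φ := φ.continuous_of_finiteDimensional
  set F : Set (Fin 3 → ℝ) := P ∩ {y | f y = M} with hF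
  have hFk : IsCompact F := h.comp.inter_right (isClosed_singleton.preimage fc)
  have hFc : Convex ℝ F := by
    apply h.conv.inter
    exact (convex_singleton M).linear_preimage f
  have hFe : IsExtreme ℝ P F := by
    refine ⟨Set.inter_subset_left, ?_⟩
    rintro y hy z hz t ⟨ht, htM⟩ ⟨p, q, hp, hq, hpq, rfl⟩
    refine ⟨hy, ?_⟩
    have h1 := h.fle y hy
    have h2 := h.fle z hz
    have h3 : p * f y + q * f z = M := by simpa using htM
    have : q = 1 - p := by linarith
    subst this
    have : f y = M := by nlinarith
    exact this
  by_contra hcon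
  push Not at hcon
  have hsub : closure (convexHull ℝ (F.extremePoints ℝ)) ⊆ {y | φ y ≤ K} := by
    apply closure_minimal
    · apply convexHull_min
      · intro y hy
        have := hFe.extremePoints_subset_extremePoints hy
        exact hcon y this hy.1.2
      · exact (convex_Iic K).linear_preimage φ
    · exact isClosed_Iic.preimage φc
  rw [closure_convexHull_extremePoints hFk hFc] at hsub
  have : φ x ≤ K := hsub ⟨hx, hfx⟩
  linarith

/-- coordinate functionals -/
lemma coord_exists {d0 d1 d2 : Fin 3 → ℝ} (h : det3 d0 d1 d2 ≠ 0) :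
    ∃ φ0 φ1 : (Fin 3 → ℝ) →ₗ[ℝ] ℝ, φ0 d0 = 1 ∧ φ0 d1 = 0 ∧ φ1 d0 = 0 ∧ φ1 d1 = 1 := by
  refine ⟨⟨⟨fun x => det3 x d1 d2 / det3 d0 d1 d2, ?_⟩, ?_⟩, ⟨⟨fun x => det3 d0 x d2 / det3 d0 d1 d2, ?_⟩, ?_⟩, ?_, ?_, ?_, ?_⟩
  · intro x y; simp only [det3, Pi.add_apply]; ring
  · intro m x; simp only [det3, Pi.smul_apply, smul_eq_mul, RingHom.id_apply]; ring
  · intro x y; simp only [det3, Pi.add_apply]; ring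
  · intro m x; simp only [det3, Pi.smul_apply, smul_eq_mul, RingHom.id_apply]; ring
  · exact div_self h
  · have : det3 d1 d1 d2 = 0 := by simp only [det3]; ring
    simp [this]
  · have : det3 d0 d0 d2 = 0 := by simp only [det3]; ring
    simp [this]
  · exact div_self h

/-- extreme points with positive coordinates -/
lemma Setup.ext012 {P C f M a u w} (h : Setup P C f M a u w) :
    (∃ b c : ℤ, toR3 (a + b • u + c • w) ∈ Set.extremePoints ℝ P ∧ 1 ≤ 1 - b - c) ∧
    (∃ b c : ℤ, toR3 (a + b • u + c • w) ∈ Set.extremePoints ℝ P ∧ 1 ≤ b) ∧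
    (∃ b c : ℤ, toR3 (a + b • u + c • w) ∈ Set.extremePoints ℝ P ∧ 1 ≤ c) := by
  obtain ⟨φ0, φ1, h00, h01, h10, h11⟩ := coord_exists h.indR
  have key : ∀ (φ : (Fin 3 → ℝ) →ₗ[ℝ] ℝ) (K : ℝ) (x : Fin 3 → ℝ), x ∈ P → f x = M → K < φ x →
      ∃ b c : ℤ, toR3 (a + b • u + c • w) ∈ Set.extremePoints ℝ P ∧ K < φ (toR3 (a + b • u + c • w)) := by
    intro φ K x h1 h2 h3
    obtain ⟨v, hv, hfv, hK⟩ := h.ext φ K x h1 h2 h3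
    obtain ⟨v', rfl, -⟩ := h.cor v hv
    obtain ⟨b, c, rfl⟩ := h.lat v' hfv
    exact ⟨b, c, hv, hK⟩
  refine ⟨?_, ?_, ?_⟩
  · obtain ⟨b, c, h1, h2⟩ := key (-φ0 - φ1) ((-φ0 - φ1) (toR3 a) - 1) (toR3 a) h.ha h.fa (by linarith)
    refine ⟨b, c, h1, ?_⟩
    simp [-zsmul_eq_mul, toR3_add, toR3_smul, h00, h01, h10, h11] at h2
    have : (0:ℝ) < 1 - b - c := by linarith
    have : 0 < 1 - b - c := by exact_mod_cast this
    omega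
  · obtain ⟨b, c, h1, h2⟩ := key φ0 (φ0 (toR3 a)) (toR3 (a + u)) h.hu (by simp [toR3_add, h.fa, h.fu])
      (by simp [toR3_add, h00])
    refine ⟨b, c, h1, ?_⟩
    simp [-zsmul_eq_mul, toR3_add, toR3_smul, h00, h01] at h2
    omega
  · obtain ⟨b, c, h1, h2⟩ := key φ1 (φ1 (toR3 a)) (toR3 (a + w)) h.hw (by simp [toR3_add, h.fa, h.fw])
      (by simp [toR3_add, h11])
    refine ⟨b, c, h1, ?_⟩
    simp [-zsmul_eq_mul, toR3_add, toR3_smul, h10, h11] at h2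
    omega


lemma Setup.corner {P C f M a u w} (h : Setup P C f M a u w) {b c : ℤ}
    (hp : toR3 (a + b • u + c • w) ∈ Set.extremePoints ℝ P) :
    ∃ d, Corner P (a + b • u + c • w) d ∧ f (toR3 (d 0)) = 0 ∧ f (toR3 (d 1)) = 0 ∧ f (toR3 (d 2)) < 0 := by
  obtain ⟨v', hv', d, hd⟩ := h.cor _ hp
  obtain rfl := toR3_inj hv'
  have hi := h.indR
  set z := toR3 (C - 2 • a)
  set p := a + b • u + c • w with hpd
  have fp : f (toR3 p) = M := h.fval b c
  have k0 : toR3 p + toR3 (a - p) ∈ P := by rw [← toR3_add]; simpa using h.ha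
  have k1 : toR3 p + toR3 (a + u - p) ∈ P := by rw [← toR3_add]; simpa using h.hu
  have k2 : toR3 p + toR3 (a + w - p) ∈ P := by rw [← toR3_add]; simpa using h.hw
  have g0 : f (toR3 (a - p)) = 0 := by rw [toR3_sub, map_sub, fp, h.fa, sub_self]
  have g1 : f (toR3 (a + u - p)) = 0 := by rw [toR3_sub, map_sub, fp, toR3_add, map_add, h.fa, h.fu]; ring
  have g2 : f (toR3 (a + w - p)) = 0 := by rw [toR3_sub, map_sub, fp, toR3_add, map_add, h.fa, h.fw]; ring
  have hb : ∀ t : ℝ, t ≠ 0 → t * det3 (toR3 u) (toR3 w) z ≠ 0 := fun t ht => mul_ne_zero ht hi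
  by_cases hc0 : c = 0
  · by_cases hb0 : b = 0
    · refine corner_face hd f M h.fle fp h.flt _ _ z k1 k2 g1 g2 ?_
      convert hb 1 one_ne_zero using 1
      rw [hpd, hc0, hb0]; simp [det3, toR3]
    · refine corner_face hd f M h.fle fp h.flt _ _ z k0 k2 g0 g2 ?_
      convert hb (-b) (by exact_mod_cast neg_ne_zero.2 hb0) using 1
      rw [hpd]; simp [det3, toR3]; ring
  · refine corner_face hd f M h.fle fp h.flt _ _ z k0 k1 g0 g1 ?_
    convert hb c (by exact_mod_cast hc0) using 1
    rw [hpd]; simp [det3, toR3]; ring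

/-- lattice points of the facet in barycentric coordinates -/
def SS (P : Set (Fin 3 → ℝ)) (a u w : Fin 3 → ℤ) : ℤ → ℤ → ℤ → Prop := fun α β γ =>
  α + β + γ = 1 ∧ toR3 (a + β • u + γ • w) ∈ P

lemma Setup.cornerAt {P C f M a u w} (h : Setup P C f M a u w) {b c : ℤ}
    (hp : toR3 (a + b • u + c • w) ∈ Set.extremePoints ℝ P) :
    CornerAt (SS P a u w) (1 - b - c) b c := by
  obtain ⟨d, hd, f0, f1, f2⟩ := h.corner hp
  have fp := h.fval b c
  obtain ⟨b0, c0, hd0⟩ := h.lat (a + b • u + c • w + d 0) (by rw [toR3_add, map_add, fp, f0, add_zero])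
  obtain ⟨b1, c1, hd1⟩ := h.lat (a + b • u + c • w + d 1) (by rw [toR3_add, map_add, fp, f1, add_zero])
  have nb0 := hd.nb 0
  have nb1 := hd.nb 1
  rw [hd0] at nb0
  rw [hd1] at nb1
  have e0 : d 0 = (b0 - b) • u + (c0 - c) • w := by
    rw [sub_smul, sub_smul]; rw [← eq_sub_iff_add_eq'] at hd0; rw [hd0]; abel
  have e1 : d 1 = (b1 - b) • u + (c1 - c) • w := by
    rw [sub_smul, sub_smul]; rw [← eq_sub_iff_add_eq'] at hd1; rw [hd1]; abel
  have hz : ∀ x y z : ℤ, f (toR3 (x • d 0 + y • d 1 + z • d 2)) = 0 → z = 0 := by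
    intro x y z hz
    rw [toR3_add, toR3_add, toR3_smul, toR3_smul, toR3_smul, map_add, map_add, map_smul, map_smul, map_smul,
      f0, f1] at hz
    simp at hz
    rcases hz with hz | hz
    · exact hz
    · exact absurd hz f2.ne
  refine ⟨(1 - b0 - c0) - (1 - b - c), b0 - b, c0 - c, (1 - b1 - c1) - (1 - b - c), b1 - b, c1 - c,
    ⟨by ring, ?_⟩, ⟨by ring, ?_⟩, ?_, ?_⟩
  · simpa only [add_sub_cancel] using nb0
  · simpa only [add_sub_cancel] using nb1
  · obtain ⟨x, y, z, hu⟩ := unimod_span hd.det u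
    obtain ⟨x', y', z', hw⟩ := unimod_span hd.det w
    have z0 : z = 0 := hz x y z (by rw [← hu]; exact h.fu)
    have z0' : z' = 0 := hz x' y' z' (by rw [← hw]; exact h.fw)
    have i1 := h.uniq (b := 1) (c := 0) (b' := x * (b0 - b) + y * (b1 - b)) (c' := x * (c0 - c) + y * (c1 - c)) (by
      rw [z0, e0, e1] at hu
      conv_lhs => rw [one_smul, zero_smul, add_zero, hu]
      simp only [smul_add, add_smul, mul_smul, zero_smul]; abel)
    have i2 := h.uniq (b := 0) (c := 1) (b' := x' * (b0 - b) + y' * (b1 - b)) (c' := x' * (c0 - c) + y' * (c1 - c)) (by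
      rw [z0', e0, e1] at hw
      conv_lhs => rw [one_smul, zero_smul, zero_add, hw]
      simp only [smul_add, add_smul, mul_smul, zero_smul]; abel)
    have : ((b0 - b) * (c1 - c) - (c0 - c) * (b1 - b)) * (x * y' - y * x') = 1 := by
      obtain ⟨p1, p2⟩ := i1
      obtain ⟨p3, p4⟩ := i2
      have q : (x * (b0 - b) + y * (b1 - b)) * (x' * (c0 - c) + y' * (c1 - c)) -
        (x * (c0 - c) + y * (c1 - c)) * (x' * (b0 - b) + y' * (b1 - b)) = 1 := by
        rw [← p1, ← p2, ← p3, ← p4]; norm_num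
      linear_combination q
    rcases Int.mul_eq_one_iff_eq_one_or_neg_one.1 this with k | k
    · left; exact k.1
    · right; exact k.1
  · rintro α β γ ⟨hs, hm⟩
    obtain ⟨n0, n1, n2, h0, h1, h2, hn⟩ := hd.int hm
    have hn' : a + β • u + γ • w - (a + b • u + c • w) = n0 • d 0 + n1 • d 1 + n2 • d 2 := by
      rw [hn]; abel
    have hz0 := hz n0 n1 n2 (by rw [← hn', toR3_sub, map_sub, h.fval, h.fval, sub_self])
    rw [hz0, e0, e1] at hn'
    have := h.uniq (b := β) (c := γ) (b' := b + n0 * (b0 - b) + n1 * (b1 - b))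
      (c' := c + n0 * (c0 - c) + n1 * (c1 - c)) (by
        have : β • u + γ • w = (a + β • u + γ • w - (a + b • u + c • w)) + (b • u + c • w) := by abel
        rw [this, hn']
        simp only [smul_add, add_smul, mul_smul, zero_smul]; abel)
    refine ⟨n0, n1, h0, h1, ?_, this.1, this.2⟩
    have hα : α = 1 - β - γ := by linarith
    rw [hα, this.1, this.2]; ring

lemma Setup.good {P C f M a u w} (h : Setup P C f M a u w) (n0 : toR3 (a + u + w) ∉ P)
    (n1 : toR3 (a + w - u) ∉ P) (n2 : toR3 (a + u - w) ∉ P) : Good (SS P a u w) where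
  sum := fun a b c h => h.1
  e0 := ⟨by norm_num, by simpa using h.ha⟩
  e1 := ⟨by norm_num, by simpa using h.hu⟩
  e2 := ⟨by norm_num, by simpa using h.hw⟩
  n0 := by rintro ⟨-, k⟩; apply n0; simpa using k
  n1 := by
    rintro ⟨-, k⟩; apply n1; convert k using 2; simp; abel
  n2 := by
    rintro ⟨-, k⟩; apply n2; convert k using 2; simp; abel
  conv := by
    rintro p0 p1 p2 q0 q1 q2 x y s0 s1 s2 r0 r1 r2 ⟨hp, hp'⟩ ⟨hq, hq'⟩ hx hy h0 h1 h2 hN i0 i1 i2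
    refine ⟨?_, ?_⟩
    · have : (x + y + s0 + s1 + s2) * (r0 + r1 + r2) = (x + y + s0 + s1 + s2) * 1 := by
        linear_combination i0 + i1 + i2 + x * hp + y * hq
      exact mul_left_cancel₀ hN.ne' this
    · have hNr : (0:ℝ) < x + y + s0 + s1 + s2 := by exact_mod_cast hN
      have j1 : ((x:ℝ) + y + s0 + s1 + s2) * r1 = x * p1 + y * q1 + s1 := by exact_mod_cast i1
      have j2 : ((x:ℝ) + y + s0 + s1 + s2) * r2 = x * p2 + y * q2 + s2 := by exact_mod_cast i2
      have hx' : (0:ℝ) ≤ x := by exact_mod_cast hx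
      have hy' : (0:ℝ) ≤ y := by exact_mod_cast hy
      have h0' : (0:ℝ) ≤ s0 := by exact_mod_cast h0
      have h1' : (0:ℝ) ≤ s1 := by exact_mod_cast h1
      have h2' : (0:ℝ) ≤ s2 := by exact_mod_cast h2
      set N : ℝ := (x:ℝ) + y + s0 + s1 + s2 with hNd
      have := h.conv.sum_mem (t := Finset.univ) (w := ![x / N, y / N, s0 / N, s1 / N, s2 / N])
        (z := ![toR3 (a + p1 • u + p2 • w), toR3 (a + q1 • u + q2 • w), toR3 a, toR3 (a + u), toR3 (a + w)])
        (by intro i _; fin_cases i <;> simp <;> positivity)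
        (by simp [Fin.sum_univ_five, ← add_div, ← hNd]; exact hNr.ne')
        (by intro i _
            fin_cases i
            · exact hp'
            · exact hq'
            · exact h.ha
            · exact h.hu
            · exact h.hw)
      convert this using 1
      ext k
      simp [Fin.sum_univ_five, toR3]
      field_simp
      linear_combination (u k : ℝ) * j1 + (w k : ℝ) * j2 + (a k : ℝ) * hNd
  cor0 := by
    obtain ⟨⟨b, c, h1, h2⟩, -, -⟩ := h.ext012
    exact ⟨1 - b - c, b, c, ⟨by ring, h1.1⟩, h2, h.cornerAt h1⟩
  cor1 := by
    obtain ⟨-, ⟨b, c, h1, h2⟩, -⟩ := h.ext012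
    exact ⟨1 - b - c, b, c, ⟨by ring, h1.1⟩, h2, h.cornerAt h1⟩
  cor2 := by
    obtain ⟨-, -, ⟨b, c, h1, h2⟩⟩ := h.ext012
    exact ⟨1 - b - c, b, c, ⟨by ring, h1.1⟩, h2, h.cornerAt h1⟩

/-- facet is a unimodular triangle -/
lemma Setup.tri {P C f M a u w} (h : Setup P C f M a u w) (n0 : toR3 (a + u + w) ∉ P)
    (n1 : toR3 (a + w - u) ∉ P) (n2 : toR3 (a + u - w) ∉ P) (b c : ℤ)
    (hp : toR3 (a + b • u + c • w) ∈ P) : 0 ≤ 1 - b - c ∧ 0 ≤ b ∧ 0 ≤ c :=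
  (h.good n0 n1 n2).main (1 - b - c) b c ⟨by ring, hp⟩


lemma Setup.swap {P C f M a u w} (h : Setup P C f M a u w) : Setup P C f M a w u where
  conv := h.conv
  comp := h.comp
  sym := h.sym
  cor := h.cor
  fle := h.fle
  fa := h.fa
  fu := h.fw
  fw := h.fu
  fC := h.fC
  ha := h.ha
  hu := h.hw
  hw := h.hu
  ind := by
    intro k; apply h.ind
    have : det3 u w (C - 2 • a) = - det3 w u (C - 2 • a) := by simp only [det3]; ring
    rw [this, k, neg_zero]
  lat := by
    intro m hm
    obtain ⟨b, c, rfl⟩ := h.lat m hm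
    exact ⟨c, b, by abel⟩

lemma Setup.rot {P C f M a u w} (h : Setup P C f M a u w) : Setup P C f M (a + u) (-u) (w - u) where
  conv := h.conv
  comp := h.comp
  sym := h.sym
  cor := h.cor
  fle := h.fle
  fa := by rw [toR3_add, map_add, h.fa, h.fu, add_zero]
  fu := by rw [toR3_neg, map_neg, h.fu, neg_zero]
  fw := by rw [toR3_sub, map_sub, h.fw, h.fu, sub_zero]
  fC := h.fC
  ha := h.hu
  hu := by simpa using h.ha
  hw := by simpa using h.hw
  ind := by
    intro k; apply h.ind
    have : det3 u w (C - 2 • a) = - det3 (-u) (w - u) (C - 2 • (a + u)) := by simp [det3]; ring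
    rw [this, k, neg_zero]
  lat := by
    intro m hm
    obtain ⟨b, c, rfl⟩ := h.lat m hm
    refine ⟨1 - b - c, c, ?_⟩
    simp only [sub_smul, smul_sub, smul_neg, one_smul]; abel

lemma Setup.tri_corner {P C f M a u w} (h : Setup P C f M a u w)
    (ht : ∀ b c : ℤ, toR3 (a + b • u + c • w) ∈ P → 0 ≤ 1 - b - c ∧ 0 ≤ b ∧ 0 ≤ c) :
    ∃ g, Corner P a ![u, w, g] ∧ f (toR3 g) < 0 := by
  obtain ⟨⟨b, c, h1, h2⟩, -, -⟩ := h.ext012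
  have := ht b c h1.1
  obtain rfl : b = 0 := by omega
  obtain rfl : c = 0 := by omega
  obtain ⟨d, hd, f0, f1, f2⟩ := h.corner h1
  simp only [zero_smul, add_zero] at hd
  have hcase : ∀ i, f (toR3 (d i)) = 0 → d i = 0 ∨ d i = u ∨ d i = w := by
    intro i hi
    obtain ⟨b, c, e⟩ := h.lat (a + d i) (by rw [toR3_add, map_add, hi, h.fa, add_zero])
    have hn := hd.nb i
    rw [e] at hn
    have := ht b c hn
    have e' : d i = b • u + c • w := by
      rw [add_assoc] at e; exact add_left_cancel e
    have : b = 0 ∧ c = 0 ∨ b = 1 ∧ c = 0 ∨ b = 0 ∧ c = 1 := by omega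
    rcases this with ⟨rfl, rfl⟩ | ⟨rfl, rfl⟩ | ⟨rfl, rfl⟩ <;> simp [e']
  have hdet : det3 (d 0) (d 1) (d 2) ≠ 0 := by
    rcases hd.det with k | k <;> rw [k] <;> norm_num
  have hd' : Corner P a ![d 0, d 1, d 2] := by
    convert hd using 1; ext i; fin_cases i <;> rfl
  have hd'' : Corner P a ![d 1, d 0, d 2] := hd.swap01
  refine ⟨d 2, ?_, f2⟩
  rcases hcase 0 f0 with k | k | k <;> rcases hcase 1 f1 with l | l | l
  all_goals first
    | (exfalso; apply hdet; rw [k, l]; simp [det3]; done)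
    | (exfalso; apply hdet; rw [k, l]; simp only [det3]; ring; done)
    | (rw [k, l] at hd'; exact hd')
    | (rw [k, l] at hd''; exact hd'')

lemma Corner.coord {P : Set (Fin 3 → ℝ)} {v d0 d1 d2 : Fin 3 → ℤ} (h : Corner P v ![d0, d1, d2]) :
    (det3 d0 d1 d2 = 1 ∨ det3 d0 d1 d2 = -1) ∧ toR3 (v + d0) ∈ P ∧ toR3 (v + d1) ∈ P ∧ toR3 (v + d2) ∈ P ∧
    (∀ m, toR3 m ∈ P → ∃ n0 n1 n2 : ℤ, 0 ≤ n0 ∧ 0 ≤ n1 ∧ 0 ≤ n2 ∧ m = v + n0 • d0 + n1 • d1 + n2 • d2) ∧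
    (∀ x ∈ P, ∃ n0 n1 n2 : ℝ, 0 ≤ n0 ∧ 0 ≤ n1 ∧ 0 ≤ n2 ∧
      x = toR3 v + n0 • toR3 d0 + n1 • toR3 d1 + n2 • toR3 d2) := by
  refine ⟨h.det, h.nb 0, h.nb 1, h.nb 2, fun m hm => h.int hm, ?_⟩
  intro x hx
  obtain ⟨c, hc, rfl⟩ := h.cone x hx
  exact ⟨c 0, c 1, c 2, hc 0, hc 1, hc 2, by simp [Fin.sum_univ_three]; abel⟩

lemma indep3Z {d0 d1 d2 : Fin 3 → ℤ} (h : det3 d0 d1 d2 ≠ 0) {a b c a' b' c' : ℤ}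
    (he : a • d0 + b • d1 + c • d2 = a' • d0 + b' • d1 + c' • d2) : a = a' ∧ b = b' ∧ c = c' := by
  have h' : det3 (toR3 d0) (toR3 d1) (toR3 d2) ≠ 0 := by rw [det3_toR3]; exact_mod_cast h
  have := congrArg toR3 he
  simp only [toR3_add, toR3_smul] at this
  have := indep3 h' this
  exact_mod_cast this

/-- half of the triangle structure -/
lemma Setup.tri_half {P C f M a u w} (h : Setup P C f M a u w)
    (ht : ∀ b c : ℤ, toR3 (a + b • u + c • w) ∈ P → 0 ≤ 1 - b - c ∧ 0 ≤ b ∧ 0 ≤ c)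
    (g : Fin 3 → ℤ) (hg : Corner P a ![u, w, g]) (fg : f (toR3 g) < 0) :
    ∃ k : ℤ, 0 ≤ k ∧ toR3 (a + g + k • u) ∈ P ∧
      (∀ x ∈ P, ∃ s1 s2 s3 : ℝ, 0 ≤ s1 ∧ 0 ≤ s2 ∧ 0 ≤ s3 ∧ s1 + s2 ≤ 1 + (k - 1) * s3 ∧
        x = toR3 a + s1 • toR3 u + s2 • toR3 w + s3 • toR3 g) := by
  obtain ⟨hdet, -, -, hag, hint, hreal⟩ := hg.coord
  obtain ⟨g1, hg1, fg1⟩ := h.rot.tri_corner (by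
    intro b c hbc
    have := ht (1 - b - c) c (by
      convert hbc using 2
      simp only [sub_smul, smul_sub, smul_neg, one_smul]; abel)
    omega)
  obtain ⟨hdet1, -, -, hag1, hint1, hreal1⟩ := hg1.coord
  have hne : det3 u w g ≠ 0 := by rcases hdet with k | k <;> rw [k] <;> norm_num
  have hneR : det3 (toR3 u) (toR3 w) (toR3 g) ≠ 0 := by rw [det3_toR3]; exact_mod_cast hne
  obtain ⟨i, j, l, hg1e⟩ := unimod_span hdet g1
  have hl : l = 1 := by
    have e1 : det3 (-u) (w - u) g1 = - (l * det3 u w g) := by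
      rw [hg1e]; simp [det3]; ring
    rw [e1] at hdet1
    have e2 : f (toR3 g1) = l * f (toR3 g) := by
      rw [hg1e]; simp [-zsmul_eq_mul, toR3_add, toR3_smul, h.fu, h.fw]
    rw [e2] at fg1
    have : (0:ℝ) < l := by
      by_contra hc
      nlinarith
    have lpos : 0 < l := by exact_mod_cast this
    rcases hdet with k | k <;> rw [k] at hdet1 <;> omega
  subst hl
  rw [one_smul] at hg1e
  -- corner at a+u applied to a+g
  obtain ⟨p, q, r, hp, hq, hr, e⟩ := hint1 _ hag
  have i1 := indep3Z hne (a := 0) (b := 0) (c := 1) (a' := 1 - p - q + r * i) (b' := q + r * j) (c' := r) (by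
    rw [hg1e] at e
    have : g = -a + (a + g) := by abel
    conv_lhs => rw [zero_smul, zero_smul, one_smul, zero_add, zero_add, this, e]
    simp only [sub_smul, smul_sub, smul_neg, one_smul, add_smul, smul_add, mul_smul]; abel)
  obtain ⟨p', q', r', hp', hq', hr', e'⟩ := hint _ hag1
  have i2 := indep3Z hne (a := 1 + i) (b := j) (c := 1) (a' := p') (b' := q') (c' := r') (by
    rw [hg1e] at e'
    have : p' • u + q' • w + r' • g = -a + (a + p' • u + q' • w + r' • g) := by abel
    rw [this, ← e']
    simp only [one_smul, add_smul]; abel)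
  have hj : j = 0 := by
    obtain ⟨-, j2, j3⟩ := i1
    rw [← j3] at j2
    linarith [i2.2.1]
  subst hj
  refine ⟨1 + i, by linarith [i2.1], ?_, ?_⟩
  · convert hag1 using 2
    rw [hg1e]; simp only [add_smul, one_smul, zero_smul]; abel
  · intro x hx
    obtain ⟨s1, s2, s3, h1, h2, h3, hxe⟩ := hreal x hx
    refine ⟨s1, s2, s3, h1, h2, h3, ?_, hxe⟩
    obtain ⟨p, q, r, hp, hq, hr, hxe'⟩ := hreal1 x hx
    have := indep3 hneR (a := s1) (b := s2) (c := s3) (a' := 1 - p - q + r * i) (b' := q) (c' := r) (by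
      rw [hg1e, hxe] at hxe'
      ext k
      have := congrFun hxe' k
      simp [toR3] at this ⊢
      linarith)
    obtain ⟨t1, t2, t3⟩ := this
    rw [t1, t2, t3]; push_cast; linarith

lemma Setup.tri_struct {P C f M a u w} (h : Setup P C f M a u w)
    (ht : ∀ b c : ℤ, toR3 (a + b • u + c • w) ∈ P → 0 ≤ 1 - b - c ∧ 0 ≤ b ∧ 0 ≤ c) :
    ∃ (g : Fin 3 → ℤ) (k : ℤ), (det3 u w g = 1 ∨ det3 u w g = -1) ∧ 0 ≤ k ∧ toR3 (a + g) ∈ P ∧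
      toR3 (a + g + k • u) ∈ P ∧ toR3 (a + g + k • w) ∈ P ∧
      (∀ x ∈ P, ∃ s1 s2 s3 : ℝ, 0 ≤ s1 ∧ 0 ≤ s2 ∧ 0 ≤ s3 ∧ s1 + s2 ≤ 1 + (k - 1) * s3 ∧
        x = toR3 a + s1 • toR3 u + s2 • toR3 w + s3 • toR3 g) := by
  obtain ⟨g, hg, fg⟩ := h.tri_corner ht
  obtain ⟨hdet, -, -, hag, hint, hreal⟩ := hg.coord
  have hne : det3 u w g ≠ 0 := by rcases hdet with k | k <;> rw [k] <;> norm_num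
  have hneR : det3 (toR3 u) (toR3 w) (toR3 g) ≠ 0 := by rw [det3_toR3]; exact_mod_cast hne
  obtain ⟨k, k0, hk, hkx⟩ := h.tri_half ht g hg fg
  obtain ⟨k', k0', hk', hkx'⟩ := h.swap.tri_half (fun b c hbc => by
    have := ht c b (by convert hbc using 2; abel)
    omega) g (by
      have := hg.swap01
      exact this) fg
  have e1 : k' ≤ k := by
    obtain ⟨s1, s2, s3, h1, h2, h3, h4, he⟩ := hkx _ hk'
    have := indep3 hneR (a := 0) (b := k') (c := 1) (a' := s1) (b' := s2) (c' := s3) (by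
      simp only [toR3_add, toR3_smul] at he
      ext i; have := congrFun he i; simp at this ⊢; linarith)
    obtain ⟨t1, t2, t3⟩ := this
    rw [← t1, ← t2, ← t3] at h4
    have : (k':ℝ) ≤ k := by linarith
    exact_mod_cast this
  have e2 : k ≤ k' := by
    obtain ⟨s1, s2, s3, h1, h2, h3, h4, he⟩ := hkx' _ hk
    have := indep3 hneR (a := k) (b := 0) (c := 1) (a' := s2) (b' := s1) (c' := s3) (by
      simp only [toR3_add, toR3_smul] at he
      ext i; have := congrFun he i; simp at this ⊢; linarith)
    obtain ⟨t1, t2, t3⟩ := this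
    rw [← t1, ← t2, ← t3] at h4
    have : (k:ℝ) ≤ k' := by linarith
    exact_mod_cast this
  obtain rfl : k = k' := le_antisymm e2 e1
  exact ⟨g, k, hdet, k0, hag, hk, hk', hkx⟩


lemma cov4 {P : Set (Fin 3 → ℝ)} (p0 p1 p2 p3 : Fin 3 → ℤ) (h0 : toR3 p0 ∈ P) (h1 : toR3 p1 ∈ P)
    (h2 : toR3 p2 ∈ P) (h3 : toR3 p3 ∈ P)
    (hd : det3 (p1 - p0) (p2 - p0) (p3 - p0) = 1 ∨ det3 (p1 - p0) (p2 - p0) (p3 - p0) = -1)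
    (c0 c1 c2 c3 : ℝ) (k0 : 0 ≤ c0) (k1 : 0 ≤ c1) (k2 : 0 ≤ c2) (k3 : 0 ≤ c3)
    (ks : c0 + c1 + c2 + c3 = 1) (x : Fin 3 → ℝ)
    (hx : x = c0 • toR3 p0 + c1 • toR3 p1 + c2 • toR3 p2 + c3 • toR3 p3) : Cov P x := by
  refine ⟨![p0, p1, p2, p3], ?_, hd, ![c0, c1, c2, c3], ?_, ?_, ?_⟩
  · intro i; fin_cases i <;> simpa
  · intro i; fin_cases i <;> simpa
  · simpa [Fin.sum_univ_four] using ks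
  · rw [hx]; simp [Fin.sum_univ_four]

lemma up_cov {P : Set (Fin 3 → ℝ)} (a u w t : Fin 3 → ℤ) (h0 : toR3 a ∈ P) (h1 : toR3 (a + u) ∈ P)
    (h2 : toR3 (a + w) ∈ P) (k0 : toR3 (a + t) ∈ P) (k1 : toR3 (a + t + u) ∈ P)
    (k2 : toR3 (a + t + w) ∈ P) (hd : det3 u w t = 1 ∨ det3 u w t = -1)
    (w1 w2 y : ℝ) (hw1 : 0 ≤ w1) (hw2 : 0 ≤ w2) (hw : w1 + w2 ≤ 1) (hy : 0 ≤ y) (hy1 : y ≤ 1)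
    (x : Fin 3 → ℝ) (hx : x = toR3 a + w1 • toR3 u + w2 • toR3 w + y • toR3 t) : Cov P x := by
  by_cases c1 : y ≤ 1 - w1 - w2
  · refine cov4 a (a + u) (a + w) (a + t) h0 h1 h2 k0 ?_ (1 - w1 - w2 - y) w1 w2 y (by linarith) hw1 hw2 hy (by ring) x ?_
    · convert hd using 2 <;> simp [det3]
    · rw [hx]; ext k; simp [toR3]; ring
  by_cases c2 : y ≤ 1 - w2
  · refine cov4 (a + t) (a + t + u) (a + u) (a + w) k0 k1 h1 h2 ?_ (1 - w1 - w2) (y - (1 - w1 - w2)) (1 - w2 - y) w2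
      (by linarith) (by linarith) (by linarith) hw2 (by ring) x ?_
    · have : det3 (a + t + u - (a + t)) (a + u - (a + t)) (a + w - (a + t)) = det3 u w t := by simp [det3]; ring
      rw [this]; exact hd
    · rw [hx]; ext k; simp [toR3]; ring
  · refine cov4 (a + t) (a + t + u) (a + t + w) (a + w) k0 k1 k2 h2 ?_ (1 - w1 - w2) w1 (y - (1 - w2)) (1 - y)
      (by linarith) (by linarith) (by linarith) (by linarith) (by ring) x ?_
    · have : det3 (a + t + u - (a + t)) (a + t + w - (a + t)) (a + w - (a + t)) = - det3 u w t := by simp [det3]; ring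
      rw [this]; omega
    · rw [hx]; ext k; simp [toR3]; ring

lemma down_cov {P : Set (Fin 3 → ℝ)} (a u w b : Fin 3 → ℤ) (h0 : toR3 a ∈ P) (h1 : toR3 (a + u) ∈ P)
    (h2 : toR3 (a + w) ∈ P) (k0 : toR3 b ∈ P) (k1 : toR3 (b - u) ∈ P)
    (k2 : toR3 (b - w) ∈ P) (hd : det3 u w (b - a) = 1 ∨ det3 u w (b - a) = -1)
    (α0 α1 α2 β0 β1 β2 : ℝ) (a0 : 0 ≤ α0) (a1 : 0 ≤ α1) (a2 : 0 ≤ α2) (b0 : 0 ≤ β0) (b1 : 0 ≤ β1) (b2 : 0 ≤ β2)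
    (hs : α0 + α1 + α2 + β0 + β1 + β2 = 1)
    (x : Fin 3 → ℝ) (hx : x = α0 • toR3 a + α1 • toR3 (a + u) + α2 • toR3 (a + w) +
      β0 • toR3 b + β1 • toR3 (b - u) + β2 • toR3 (b - w)) : Cov P x := by
  rcases le_total α1 β1 with c1 | c1 <;> rcases le_total α2 β2 with c2 | c2
  · refine cov4 a b (b - u) (b - w) h0 k0 k1 k2 ?_ (α0 + α1 + α2) (β0 + α1 + α2) (β1 - α1) (β2 - α2)
      (by linarith) (by linarith) (by linarith) (by linarith) (by linarith) x ?_
    · have : det3 (b - a) (b - u - a) (b - w - a) = det3 u w (b - a) := by simp [det3]; ring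
      rw [this]; exact hd
    · rw [hx]; ext k; simp [toR3]; ring
  · refine cov4 a b (b - u) (a + w) h0 k0 k1 h2 ?_ (α0 + α1 + β2) (β0 + α1 + β2) (β1 - α1) (α2 - β2)
      (by linarith) (by linarith) (by linarith) (by linarith) (by linarith) x ?_
    · have : det3 (b - a) (b - u - a) (a + w - a) = - det3 u w (b - a) := by simp [det3]; ring
      rw [this]; omega
    · rw [hx]; ext k; simp [toR3]; ring
  · refine cov4 a b (a + u) (b - w) h0 k0 h1 k2 ?_ (α0 + β1 + α2) (β0 + β1 + α2) (α1 - β1) (β2 - α2)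
      (by linarith) (by linarith) (by linarith) (by linarith) (by linarith) x ?_
    · have : det3 (b - a) (a + u - a) (b - w - a) = - det3 u w (b - a) := by simp [det3]; ring
      rw [this]; omega
    · rw [hx]; ext k; simp [toR3]; ring
  · refine cov4 a b (a + u) (a + w) h0 k0 h1 h2 ?_ (α0 + β1 + β2) (β0 + β1 + β2) (α1 - β1) (α2 - β2)
      (by linarith) (by linarith) (by linarith) (by linarith) (by linarith) x ?_
    · have : det3 (b - a) (a + u - a) (a + w - a) = det3 u w (b - a) := by simp [det3]; ring
      rw [this]; exact hd
    · rw [hx]; ext k; simp [toR3]; ring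

lemma tri_cell (k : ℤ) (hk : 1 ≤ k) (p q : ℝ) (hp : 0 ≤ p) (hq : 0 ≤ q) (hpq : p + q ≤ k) :
    (∃ i j : ℤ, 0 ≤ i ∧ 0 ≤ j ∧ i + j + 1 ≤ k ∧ ∃ l1 l2 : ℝ, 0 ≤ l1 ∧ 0 ≤ l2 ∧ l1 + l2 ≤ 1 ∧
      p = i + l1 ∧ q = j + l2) ∨
    (∃ i j : ℤ, 0 ≤ i ∧ 0 ≤ j ∧ i + j + 2 ≤ k ∧ ∃ l1 l2 : ℝ, 0 ≤ l1 ∧ 0 ≤ l2 ∧ l1 + l2 ≤ 1 ∧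
      p = i + 1 - l1 ∧ q = j + 1 - l2) := by
  have i0 : 0 ≤ ⌊p⌋ := Int.floor_nonneg.2 hp
  have j0 : 0 ≤ ⌊q⌋ := Int.floor_nonneg.2 hq
  have ep := Int.floor_add_fract p
  have eq := Int.floor_add_fract q
  have fp := Int.fract_nonneg p
  have fq := Int.fract_nonneg q
  have fp1 := (Int.fract_lt_one p).le
  have fq1 := (Int.fract_lt_one q).le
  have hle : ⌊p⌋ + ⌊q⌋ ≤ k := by
    have : ((⌊p⌋ + ⌊q⌋ : ℤ) : ℝ) ≤ k := by push_cast; linarith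
    exact_mod_cast this
  by_cases hf : Int.fract p + Int.fract q ≤ 1
  · left
    by_cases hk' : ⌊p⌋ + ⌊q⌋ + 1 ≤ k
    · exact ⟨_, _, i0, j0, hk', _, _, fp, fq, hf, ep.symm, eq.symm⟩
    · have hek : ⌊p⌋ + ⌊q⌋ = k := by omega
      have : (⌊p⌋:ℝ) + ⌊q⌋ = k := by exact_mod_cast hek
      have z1 : Int.fract p = 0 := by linarith
      have z2 : Int.fract q = 0 := by linarith
      by_cases hi : 1 ≤ ⌊p⌋
      · exact ⟨⌊p⌋ - 1, ⌊q⌋, by omega, j0, by omega, 1, 0, by norm_num, by norm_num, by norm_num, by push_cast; linarith, by linarith⟩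
      · exact ⟨⌊p⌋, ⌊q⌋ - 1, i0, by omega, by omega, 0, 1, by norm_num, by norm_num, by norm_num, by linarith, by push_cast; linarith⟩
  · right
    refine ⟨⌊p⌋, ⌊q⌋, i0, j0, ?_, 1 - Int.fract p, 1 - Int.fract q, by linarith, by linarith, by linarith, by linarith, by linarith⟩
    have : ((⌊p⌋ + ⌊q⌋ : ℤ) : ℝ) < ((k - 1 : ℤ) : ℝ) := by push_cast; linarith
    have : ⌊p⌋ + ⌊q⌋ < k - 1 := by exact_mod_cast this
    omega

lemma conv3 {P : Set (Fin 3 → ℝ)} (hc : Convex ℝ P) {x y z : Fin 3 → ℝ} (hx : x ∈ P) (hy : y ∈ P) (hz : z ∈ P)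
    {α β γ : ℝ} (h1 : 0 ≤ α) (h2 : 0 ≤ β) (h3 : 0 ≤ γ) (hs : α + β + γ = 1) : α • x + β • y + γ • z ∈ P := by
  have := hc.sum_mem (t := Finset.univ) (w := ![α, β, γ]) (z := ![x, y, z])
    (by intro i _; fin_cases i <;> simpa) (by simpa [Fin.sum_univ_three] using hs)
    (by intro i _; fin_cases i <;> simpa)
  simpa [Fin.sum_univ_three] using this

lemma level1 {P : Set (Fin 3 → ℝ)} (hc : Convex ℝ P) {b u w : Fin 3 → ℤ} {k : ℤ} (hk : 1 ≤ k)
    (h0 : toR3 b ∈ P) (h1 : toR3 (b + k • u) ∈ P) (h2 : toR3 (b + k • w) ∈ P) (i j : ℤ)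
    (hi : 0 ≤ i) (hj : 0 ≤ j) (hij : i + j ≤ k) : toR3 (b + i • u + j • w) ∈ P := by
  have hk0 : (0:ℝ) < k := by exact_mod_cast hk
  have hi' : (0:ℝ) ≤ i := by exact_mod_cast hi
  have hj' : (0:ℝ) ≤ j := by exact_mod_cast hj
  have hij' : (i:ℝ) + j ≤ k := by exact_mod_cast hij
  have := conv3 hc h0 h1 h2 (α := 1 - i / k - j / k) (β := i / k) (γ := j / k) (by
    have : (i:ℝ)/k + j/k ≤ 1 := by rw [← add_div, div_le_one hk0]; exact hij'
    linarith) (by positivity) (by positivity) (by ring)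
  convert this using 1
  ext l
  simp [toR3]; field_simp; ring


/-- coverage over a plane section at level one -/
lemma sect_cov {P : Set (Fin 3 → ℝ)} (hc : Convex ℝ P) (C : Fin 3 → ℤ)
    (hC : ∀ x, x ∈ P → toR3 C - x ∈ P) (b u w : Fin 3 → ℤ) (k : ℤ) (hk : 2 ≤ k)
    (hL : ∀ i j : ℤ, 0 ≤ i → 0 ≤ j → i + j ≤ k → toR3 (b + i • u + j • w) ∈ P)
    (hd : det3 u w (C - 2 • b) ≠ 0) (p q τ : ℝ) (hp : 0 ≤ p) (hq : 0 ≤ q) (hpq : p + q ≤ k)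
    (hτ : 0 ≤ τ ∧ τ ≤ 1) (x : Fin 3 → ℝ)
    (hx : x = (1 - τ) • ((1 / 2 : ℝ) • toR3 C) + τ • (toR3 b + p • toR3 u + q • toR3 w)) : Cov P x := by
  have main : ∀ (i j : ℤ) (l1 l2 : ℝ), 0 ≤ i → 0 ≤ j → i + j + 2 ≤ k → (0 ≤ l1 ∧ l1 ≤ 1) → (0 ≤ l2 ∧ l2 ≤ 1) →
      p = i + l1 → q = j + l2 → Cov P x := by
    intro i j l1 l2 hi hj hij h1 h2 e1 e2
    refine par_cov hc C hC (b + i • u + j • w) u w (hL _ _ hi hj (by omega)) ?_ ?_ ?_ ?_ l1 l2 τ h1 h2 hτ x ?_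
    · convert hL (i+1) j (by omega) hj (by omega) using 2; simp only [add_smul, one_smul]; abel
    · convert hL i (j+1) hi (by omega) (by omega) using 2; simp only [add_smul, one_smul]; abel
    · convert hL (i+1) (j+1) (by omega) (by omega) (by omega) using 2; simp only [add_smul, one_smul]; abel
    · convert hd using 1; simp [det3]; ring
    · rw [hx, e1, e2]; ext k; simp [toR3]; ring
  rcases tri_cell k (by omega) p q hp hq hpq with ⟨i, j, hi, hj, hij, l1, l2, h1, h2, h3, e1, e2⟩ | ⟨i, j, hi, hj, hij, l1, l2, h1, h2, h3, e1, e2⟩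
  · by_cases hk2 : i + j + 2 ≤ k
    · exact main i j l1 l2 hi hj hk2 ⟨h1, by linarith⟩ ⟨h2, by linarith⟩ e1 e2
    by_cases hi1 : 1 ≤ i
    · refine par_cov hc C hC (b + i • u + j • w) u (w - u) (hL _ _ hi hj (by omega)) ?_ ?_ ?_ ?_ (l1 + l2) l2 τ ⟨by linarith, h3⟩ ⟨h2, by linarith⟩ hτ x ?_
      · convert hL (i+1) j (by omega) hj (by omega) using 2; simp only [add_smul, one_smul]; abel
      · convert hL (i-1) (j+1) (by omega) (by omega) (by omega) using 2; simp only [sub_smul, add_smul, one_smul]; abel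
      · convert hL (i) (j+1) (by omega) (by omega) (by omega) using 2; simp only [add_smul, one_smul]; abel
      · convert hd using 1; simp [det3]; ring
      · rw [hx, e1, e2]; ext k; simp [toR3]; ring
    · refine par_cov hc C hC (b + i • u + j • w) w (u - w) (hL _ _ hi hj (by omega)) ?_ ?_ ?_ ?_ (l1 + l2) l1 τ ⟨by linarith, h3⟩ ⟨h1, by linarith⟩ hτ x ?_
      · convert hL i (j+1) (by omega) (by omega) (by omega) using 2; simp only [add_smul, one_smul]; abel
      · convert hL (i+1) (j-1) (by omega) (by omega) (by omega) using 2; simp only [sub_smul, add_smul, one_smul]; abel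
      · convert hL (i+1) (j) (by omega) (by omega) (by omega) using 2; simp only [add_smul, one_smul]; abel
      · rw [← neg_ne_zero]; convert hd using 1; simp [det3]; ring
      · rw [hx, e1, e2]; ext k; simp [toR3]; ring
  · exact main i j (1 - l1) (1 - l2) hi hj hij ⟨by linarith, by linarith⟩ ⟨by linarith, by linarith⟩ (by linarith) (by linarith)

lemma Setup.tri_cov {P C f M a u w} (h : Setup P C f M a u w)
    (ht : ∀ b c : ℤ, toR3 (a + b • u + c • w) ∈ P → 0 ≤ 1 - b - c ∧ 0 ≤ b ∧ 0 ≤ c)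
    (s1 s2 τ : ℝ) (h1 : 0 ≤ s1) (h2 : 0 ≤ s2) (h12 : s1 + s2 ≤ 1) (hτ : 0 ≤ τ ∧ τ ≤ 1)
    (x : Fin 3 → ℝ)
    (hx : x = (1 - τ) • ((1 / 2 : ℝ) • toR3 C) + τ • (toR3 a + s1 • toR3 u + s2 • toR3 w)) : Cov P x := by
  obtain ⟨g, k, hdet, hk0, hg0, hg1, hg2, hP⟩ := h.tri_struct ht
  have hne : det3 u w g ≠ 0 := by rcases hdet with k | k <;> rw [k] <;> norm_num
  have hneR : det3 (toR3 u) (toR3 w) (toR3 g) ≠ 0 := by rw [det3_toR3]; exact_mod_cast hne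
  obtain ⟨C1, C2, H, hCe⟩ := unimod_span hdet (C - 2 • a)
  have hco : ∀ p q r : ℝ, toR3 a + p • toR3 u + q • toR3 w + r • toR3 g ∈ P →
      0 ≤ p ∧ 0 ≤ q ∧ 0 ≤ r ∧ p + q ≤ 1 + (k - 1) * r := by
    intro p q r hm
    obtain ⟨p', q', r', a1, a2, a3, a4, e⟩ := hP _ hm
    obtain ⟨rfl, rfl, rfl⟩ := indep3 hneR (a := p) (b := q) (c := r) (a' := p') (b' := q') (c' := r') (by
      ext l; have := congrFun e l; simp at this ⊢; linarith)
    exact ⟨a1, a2, a3, a4⟩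
  have hCk : ∀ l, (C l : ℝ) = 2 * a l + C1 * u l + C2 * w l + H * g l := by
    intro l
    have : C l = 2 * a l + C1 * u l + C2 * w l + H * g l := by
      have := congrFun hCe l; simp at this; linarith
    exact_mod_cast this
  have q0 := hco C1 C2 H (by
    convert h.sym _ h.ha using 1; ext l; simp [toR3, hCk]; ring)
  have q1 := hco (C1 - 1) C2 H (by
    convert h.sym _ h.hu using 1; ext l; simp [toR3, hCk]; ring)
  have q2 := hco C1 (C2 - 1) H (by
    convert h.sym _ h.hw using 1; ext l; simp [toR3, hCk]; ring)
  have r1 : (1:ℤ) ≤ C1 := by have := q1.1; have : (1:ℝ) ≤ C1 := by linarith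
                             exact_mod_cast this
  have r2 : (1:ℤ) ≤ C2 := by have := q2.2.1; have : (1:ℝ) ≤ C2 := by linarith
                             exact_mod_cast this
  have r3 : (0:ℤ) ≤ H := by exact_mod_cast q0.2.2.1
  have r4 : C1 + C2 ≤ 1 + (k - 1) * H := by exact_mod_cast q0.2.2.2
  have hk2 : 2 ≤ k := by
    by_contra hcon
    have : (k - 1) * H ≤ 0 := mul_nonpos_of_nonpos_of_nonneg (by omega) r3
    omega
  have hL := level1 h.conv (by omega : 1 ≤ k) hg0 hg1 hg2
  have hk2R : (2:ℝ) ≤ k := by exact_mod_cast hk2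
  -- centre and z in P
  have hcen : (1/2:ℝ) • toR3 C ∈ P := by
    have := conv2 h.conv h.ha (h.sym _ h.ha) (s := 1/2) (by norm_num) (by norm_num)
    convert this using 1; ext l; simp; ring
  have hz : toR3 a + s1 • toR3 u + s2 • toR3 w ∈ P := by
    have := conv3 h.conv h.ha h.hu h.hw (α := 1 - s1 - s2) (β := s1) (γ := s2) (by linarith) h1 h2 (by ring)
    convert this using 1; ext l; simp [toR3]; ring
  have hxP : x ∈ P := by
    rw [hx]; exact conv2 h.conv hcen hz hτ.1 hτ.2
  obtain ⟨x1, hx1⟩ : ∃ x1 : ℝ, x1 = (1 - τ) * C1 / 2 + τ * s1 := ⟨_, rfl⟩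
  obtain ⟨x2, hx2⟩ : ∃ x2 : ℝ, x2 = (1 - τ) * C2 / 2 + τ * s2 := ⟨_, rfl⟩
  obtain ⟨x3, hx3⟩ : ∃ x3 : ℝ, x3 = (1 - τ) * H / 2 := ⟨_, rfl⟩
  have hxe : x = toR3 a + x1 • toR3 u + x2 • toR3 w + x3 • toR3 g := by
    rw [hx, hx1, hx2, hx3]; ext l; simp [toR3, hCk]; ring
  have := hxP; rw [hxe] at this
  obtain ⟨p1, p2, p3, p4⟩ := hco _ _ _ this
  by_cases hle : x3 ≤ 1
  · have hR : 0 < 1 + (k - 1) * x3 := by nlinarith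
    obtain ⟨R, hRe⟩ : ∃ R, R = 1 + (k - 1) * x3 := ⟨_, rfl⟩
    rw [← hRe] at hR p4
    obtain ⟨n1, hn1⟩ : ∃ n1, n1 = x1 / R := ⟨_, rfl⟩
    obtain ⟨n2, hn2⟩ : ∃ n2, n2 = x2 / R := ⟨_, rfl⟩
    have n10 : 0 ≤ n1 := by rw [hn1]; positivity
    have n20 : 0 ≤ n2 := by rw [hn2]; positivity
    have n12 : n1 + n2 ≤ 1 := by rw [hn1, hn2, ← add_div, div_le_one hR]; exact p4
    have xn1 : x1 = n1 * (1 + (k - 1) * x3) := by rw [hn1, ← hRe]; field_simp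
    have xn2 : x2 = n2 * (1 + (k - 1) * x3) := by rw [hn2, ← hRe]; field_simp
    rcases tri_cell k (by omega) (k * n1) (k * n2) (by positivity) (by positivity) (by nlinarith) with
      ⟨i, j, hi, hj, hij, l1, l2, y1, y2, y3, e1, e2⟩ | ⟨i, j, hi, hj, hij, l1, l2, y1, y2, y3, e1, e2⟩
    · refine up_cov a u w (g + i • u + j • w) h.ha h.hu h.hw ?_ ?_ ?_ ?_ ((1 - x3) * n1 + x3 * l1)
        ((1 - x3) * n2 + x3 * l2) x3 ?_ ?_ ?_ p3 hle x ?_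
      · convert hL i j hi hj (by omega) using 2; abel
      · convert hL (i+1) j (by omega) hj (by omega) using 2; simp only [add_smul, one_smul]; abel
      · convert hL i (j+1) (by omega) (by omega) (by omega) using 2; simp only [add_smul, one_smul]; abel
      · convert hdet using 2 <;> simp [det3] <;> ring
      · have := mul_nonneg (sub_nonneg.2 hle) n10; have := mul_nonneg p3 y1; linarith
      · have := mul_nonneg (sub_nonneg.2 hle) n20; have := mul_nonneg p3 y2; linarith
      · have := mul_le_mul_of_nonneg_left n12 (sub_nonneg.2 hle); have := mul_le_mul_of_nonneg_left y3 p3; linarith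
      · rw [hxe]
        have E1 : x1 = (1 - x3) * n1 + x3 * (i + l1) := by rw [← e1, xn1]; ring
        have E2 : x2 = (1 - x3) * n2 + x3 * (j + l2) := by rw [← e2, xn2]; ring
        rw [E1, E2]; ext l; simp [toR3]; ring
    · refine down_cov a u w (a + g + (i+1) • u + (j+1) • w) h.ha h.hu h.hw (hL _ _ (by omega) (by omega) (by omega)) ?_ ?_ ?_
        ((1 - x3) * (1 - n1 - n2)) ((1 - x3) * n1) ((1 - x3) * n2) (x3 * (1 - l1 - l2)) (x3 * l1) (x3 * l2)
        (mul_nonneg (by linarith) (by linarith)) (mul_nonneg (by linarith) n10) (mul_nonneg (by linarith) n20)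
        (mul_nonneg p3 (by linarith)) (mul_nonneg p3 y1) (mul_nonneg p3 y2) (by ring) x ?_
      · convert hL i (j+1) hi (by omega) (by omega) using 2; simp only [add_smul, one_smul]; abel
      · convert hL (i+1) j (by omega) (by omega) (by omega) using 2; simp only [add_smul, one_smul]; abel
      · convert hdet using 2 <;> simp [det3] <;> ring
      · rw [hxe]
        have E1 : x1 = (1 - x3) * n1 + x3 * (i + 1 - l1) := by rw [← e1, xn1]; ring
        have E2 : x2 = (1 - x3) * n2 + x3 * (j + 1 - l2) := by rw [← e2, xn2]; ring
        rw [E1, E2]; ext l; simp [toR3]; ring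
  · push Not at hle
    have hH2 : (2:ℝ) < H := by
      have : (0:ℝ) ≤ H := by exact_mod_cast r3
      nlinarith [hτ.1]
    have hH2' : 2 < H := by exact_mod_cast hH2
    obtain ⟨τ', hτ'⟩ : ∃ t : ℝ, t = 1 - 2 / H := ⟨_, rfl⟩
    have hHτ : H * τ' = H - 2 := by rw [hτ']; field_simp
    have t0 : 0 < τ' := by nlinarith
    have t1 : τ' ≤ 1 := by nlinarith
    have hττ : τ < τ' := by nlinarith
    obtain ⟨p, hp⟩ : ∃ p : ℝ, p = (1 - τ') * C1 / 2 + τ' * s1 := ⟨_, rfl⟩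
    obtain ⟨q, hq⟩ : ∃ p : ℝ, p = (1 - τ') * C2 / 2 + τ' * s2 := ⟨_, rfl⟩
    have hH1 : (1 - τ') * H / 2 = 1 := by linarith
    have hz'e : (1 - τ') • ((1 / 2 : ℝ) • toR3 C) + τ' • (toR3 a + s1 • toR3 u + s2 • toR3 w) =
        toR3 a + p • toR3 u + q • toR3 w + (1:ℝ) • toR3 g := by
      rw [hp, hq]; ext l; simp [toR3, hCk]; linear_combination (g l : ℝ) * hH1
    have hz' := conv2 h.conv hcen hz t0.le t1
    have hz'2 := hz'
    rw [hz'e] at hz'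
    obtain ⟨u1, u2, -, u4⟩ := hco _ _ _ hz'
    refine sect_cov h.conv C h.sym (a + g) u w k hk2 hL ?_ p q (τ / τ') u1 u2 (by linarith)
      ⟨div_nonneg hτ.1 t0.le, (div_le_one t0).2 hττ.le⟩ x ?_
    · have : det3 u w (C - 2 • (a + g)) = (H - 2) * det3 u w g := by
        have : C - 2 • (a + g) = C1 • u + C2 • w + (H - 2) • g := by
          have : C - 2 • (a + g) = (C - 2 • a) - 2 • g := by simp only [smul_add]; abel
          rw [this, hCe]; simp only [sub_smul]
          have : (2:ℤ) • g = (2:ℕ) • g := by ext l; simp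
          rw [this]; abel
        rw [this]; simp [det3]; ring
      rw [this]; exact mul_ne_zero (by omega) hne
    · have : toR3 (a + g) + p • toR3 u + q • toR3 w =
         (1 - τ') • ((1 / 2 : ℝ) • toR3 C) + τ' • (toR3 a + s1 • toR3 u + s2 • toR3 w) := by
        rw [hz'e, toR3_add]; simp; abel
      rw [this, hx]
      have : τ = (τ / τ') * τ' := by field_simp
      set σ := τ / τ'
      rw [this]
      ext l; simp; ring

lemma Setup.facet_cov {P C f M a u w} (h : Setup P C f M a u w)
    (s1 s2 τ : ℝ) (h1 : 0 ≤ s1) (h2 : 0 ≤ s2) (h12 : s1 + s2 ≤ 1) (hτ : 0 ≤ τ ∧ τ ≤ 1)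
    (x : Fin 3 → ℝ)
    (hx : x = (1 - τ) • ((1 / 2 : ℝ) • toR3 C) + τ • (toR3 a + s1 • toR3 u + s2 • toR3 w)) : Cov P x := by
  by_cases n0 : toR3 (a + u + w) ∈ P
  · exact par_cov h.conv C h.sym a u w h.ha h.hu h.hw n0 h.ind s1 s2 τ ⟨h1, by linarith⟩ ⟨h2, by linarith⟩ hτ x hx
  by_cases n1 : toR3 (a + w - u) ∈ P
  · refine par_cov h.conv C h.sym a u (w - u) h.ha h.hu ?_ ?_ ?_ (s1 + s2) s2 τ ⟨by linarith, h12⟩ ⟨h2, by linarith⟩ hτ x ?_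
    · convert n1 using 2; abel
    · convert h.hw using 2; abel
    · convert h.ind using 1; simp [det3]; ring
    · rw [hx]; ext k; simp [toR3]; ring
  by_cases n2 : toR3 (a + u - w) ∈ P
  · refine par_cov h.conv C h.sym a w (u - w) h.ha h.hw ?_ ?_ ?_ (s1 + s2) s1 τ ⟨by linarith, h12⟩ ⟨h1, by linarith⟩ hτ x ?_
    · convert n2 using 2; abel
    · convert h.hu using 2; abel
    · rw [← neg_ne_zero]; convert h.ind using 1; simp [det3]; ring
    · rw [hx]; ext k; simp [toR3]; ring
  exact h.tri_cov (h.tri n0 n1 n2) s1 s2 τ h1 h2 h12 hτ x hx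


lemma plane_coef {f : (Fin 3 → ℝ) →ₗ[ℝ] ℝ} {M : ℝ} {v : Fin 4 → Fin 3 → ℤ} 
    (hf : ∀ i, i ≠ 3 → f (toR3 (v i)) = M) (hf3 : f (toR3 (v 3)) ≠ M) {μ : Fin 4 → ℝ}
    (hs : ∑ i, μ i = 1) {x : Fin 3 → ℝ} (hx : x = ∑ i, μ i • toR3 (v i)) (hfx : f x = M) : μ 3 = 0 := by
  rw [hx, map_sum] at hfx
  simp only [Fin.sum_univ_four, map_smul, smul_eq_mul, hf 0 (by decide), hf 1 (by decide), hf 2 (by decide)] at hs hfx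
  have : μ 3 * (f (toR3 (v 3)) - M) = 0 := by linear_combination hfx - M * hs
  rcases mul_eq_zero.1 this with h | h
  · exact h
  · exact absurd (sub_eq_zero.1 h) hf3

lemma plane_descent {P : Set (Fin 3 → ℝ)} (hc : Convex ℝ P) (f : (Fin 3 → ℝ) →ₗ[ℝ] ℝ) (M : ℝ)
    (o : Fin 3 → ℤ) (ho : f (toR3 o) ≠ M) (z : Fin 3 → ℝ) (n : ℕ) :
    ∀ v : Fin 4 → Fin 3 → ℤ, v 3 = o → (∀ i, i ≠ 3 → toR3 (v i) ∈ P) →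
      (∀ i, i ≠ 3 → f (toR3 (v i)) = M) → tdet v ≠ 0 → (tdet v).natAbs = n → InTet v z →
    ∃ v : Fin 4 → Fin 3 → ℤ, v 3 = o ∧ (∀ i, i ≠ 3 → toR3 (v i) ∈ P) ∧
      (∀ i, i ≠ 3 → f (toR3 (v i)) = M) ∧ tdet v ≠ 0 ∧ InTet v z ∧
      ∀ m, f (toR3 m) = M → ∃ b c : ℤ, m = v 0 + b • (v 1 - v 0) + c • (v 2 - v 0) := by
  induction n using Nat.strong_induction_on with
  | _ n ih =>
  intro v h3 hvP hvf hD hn hz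
  by_cases hl : ∀ m, f (toR3 m) = M → ∃ b c : ℤ, m = v 0 + b • (v 1 - v 0) + c • (v 2 - v 0)
  · exact ⟨v, h3, hvP, hvf, hD, hz, hl⟩
  push Not at hl
  obtain ⟨m, hm, hmn⟩ := hl
  obtain ⟨μ, hμs, hμ⟩ := exists_bary v hD (toR3 m)
  have hμ3 := plane_coef hvf (by rw [h3]; exact ho) hμs hμ hm
  have step : ∀ (q : Fin 3 → ℤ) (κ : Fin 4 → ℝ), ∑ i, κ i = 1 → (∀ i, 0 ≤ κ i ∧ κ i < 1) → κ 3 = 0 →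
      toR3 q = ∑ i, κ i • toR3 (v i) → ∃ v : Fin 4 → Fin 3 → ℤ, v 3 = o ∧ (∀ i, i ≠ 3 → toR3 (v i) ∈ P) ∧
      (∀ i, i ≠ 3 → f (toR3 (v i)) = M) ∧ tdet v ≠ 0 ∧ InTet v z ∧
      ∀ m, f (toR3 m) = M → ∃ b c : ℤ, m = v 0 + b • (v 1 - v 0) + c • (v 2 - v 0) := by
    intro q κ κs κb κ3 hq
    obtain ⟨i, hi, hne, hlt, hin⟩ := flip_lt v hD q κ κs (fun i => (κb i).2) hq z hz
    have hi3 : i ≠ 3 := by rintro rfl; linarith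
    refine ih _ (hn ▸ hlt) (Function.update v i q) ?_ ?_ ?_ hne rfl hin
    · rw [Function.update_of_ne hi3.symm]; exact h3
    · intro j hj
      by_cases hji : j = i
      · subst hji
        rw [Function.update_self, hq, Fin.sum_univ_four, κ3, zero_smul, add_zero]
        rw [Fin.sum_univ_four, κ3, add_zero] at κs
        exact conv3 hc (hvP 0 (by decide)) (hvP 1 (by decide)) (hvP 2 (by decide)) (κb 0).1 (κb 1).1 (κb 2).1 κs
      · rw [Function.update_of_ne hji]; exact hvP j hj
    · intro j hj
      by_cases hji : j = i
      · subst hji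
        rw [Function.update_self, hq, Fin.sum_univ_four, κ3, zero_smul, add_zero]
        rw [Fin.sum_univ_four, κ3, add_zero] at κs
        simp only [map_add, map_smul, smul_eq_mul, hvf 0 (by decide), hvf 1 (by decide), hvf 2 (by decide)]
        linear_combination M * κs
      · rw [Function.update_of_ne hji]; exact hvf j hj
  rw [Fin.sum_univ_four, hμ3, add_zero] at hμs
  rw [Fin.sum_univ_four, hμ3, zero_smul, add_zero] at hμ
  have e0 := Int.floor_add_fract (μ 0)
  have e1 := Int.floor_add_fract (μ 1)
  have e2 := Int.floor_add_fract (μ 2)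
  have a0 := Int.fract_nonneg (μ 0)
  have a1 := Int.fract_nonneg (μ 1)
  have a2 := Int.fract_nonneg (μ 2)
  have b0 := Int.fract_lt_one (μ 0)
  have b1 := Int.fract_lt_one (μ 1)
  have b2 := Int.fract_lt_one (μ 2)
  set n0 := ⌊μ 0⌋
  set n1 := ⌊μ 1⌋
  set n2 := ⌊μ 2⌋
  obtain ⟨S, hS⟩ : ∃ S : ℤ, S = 1 - n0 - n1 - n2 := ⟨_, rfl⟩
  have hSR : (S:ℝ) = Int.fract (μ 0) + Int.fract (μ 1) + Int.fract (μ 2) := by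
    rw [hS]; push_cast; linarith
  have S0 : 0 ≤ S := by have : (0:ℝ) ≤ S := by linarith
                        exact_mod_cast this
  have S3 : S < 3 := by have : (S:ℝ) < 3 := by linarith
                        exact_mod_cast this
  have hmk : ∀ k, (m k : ℝ) = μ 0 * v 0 k + μ 1 * v 1 k + μ 2 * v 2 k := by
    intro k; have := congrFun hμ k; simpa [toR3] using this
  obtain rfl | rfl | rfl : S = 0 ∨ S = 1 ∨ S = 2 := by omega
  · exfalso
    apply hmn n1 n2
    have f0 : μ 0 = n0 := by push_cast at hSR; linarith
    have f1 : μ 1 = n1 := by push_cast at hSR; linarith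
    have f2 : μ 2 = n2 := by push_cast at hSR; linarith
    ext k
    have := hmk k
    rw [f0, f1, f2] at this
    have h' : m k = n0 * v 0 k + n1 * v 1 k + n2 * v 2 k := by exact_mod_cast this
    rw [h']
    have : n0 = 1 - n1 - n2 := by omega
    rw [this]; simp; ring
  · push_cast at hSR
    refine step (m - n0 • v 0 - n1 • v 1 - n2 • v 2) ![Int.fract (μ 0), Int.fract (μ 1), Int.fract (μ 2), 0] ?_ ?_ rfl ?_
    · simp only [Fin.sum_univ_four]; simp; linarith
    · intro i; fin_cases i <;> simp <;> first | exact ⟨by assumption, by assumption⟩ | assumption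
    · ext k
      simp only [Fin.sum_univ_four]
      simp [toR3]
      rw [hmk k, ← e0, ← e1, ← e2]
      simp only [e0, e1, e2]; 
      linear_combination (v 0 k : ℝ) * (-e0) + (v 1 k : ℝ) * (-e1) + (v 2 k : ℝ) * (-e2)
  · push_cast at hSR
    refine step (v 0 + v 1 + v 2 - (m - n0 • v 0 - n1 • v 1 - n2 • v 2))
      ![1 - Int.fract (μ 0), 1 - Int.fract (μ 1), 1 - Int.fract (μ 2), 0] ?_ ?_ rfl ?_
    · simp only [Fin.sum_univ_four]; simp; linarith
    · intro i; fin_cases i <;> simp only [Fin.mk_zero, Fin.mk_one, Fin.reduceFinMk, Matrix.cons_val] <;> constructor <;> linarith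
    · ext k
      simp only [Fin.sum_univ_four]
      simp [toR3]
      rw [hmk k]
      linear_combination (v 0 k : ℝ) * e0 + (v 1 k : ℝ) * e1 + (v 2 k : ℝ) * e2

lemma facet_final {P : Set (Fin 3 → ℝ)} {C : Fin 3 → ℤ} {f : (Fin 3 → ℝ) →ₗ[ℝ] ℝ} {M : ℝ}
    (conv : Convex ℝ P) (comp : IsCompact P) (sym : ∀ x ∈ P, toR3 C - x ∈ P)
    (cor : ∀ v ∈ Set.extremePoints ℝ P, ∃ v', toR3 v' = v ∧ ∃ d, Corner P v' d)
    (fle : ∀ x ∈ P, f x ≤ M) (fC : f (toR3 C) < 2 * M) (p : Fin 3 → Fin 3 → ℤ)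
    (hp : ∀ i, toR3 (p i) ∈ P) (hpf : ∀ i, f (toR3 (p i)) = M)
    (hind : det3 (p 1 - p 0) (p 2 - p 0) (C - 2 • p 0) ≠ 0) (ξ : Fin 3 → ℝ) (h0 : ∀ i, 0 ≤ ξ i)
    (h1 : ∑ i, ξ i = 1) (τ : ℝ) (hτ : 0 ≤ τ ∧ τ ≤ 1) (x : Fin 3 → ℝ)
    (hx : x = (1 - τ) • ((1 / 2 : ℝ) • toR3 C) + τ • ∑ i, ξ i • toR3 (p i)) : Cov P x := by
  set o := C - p 0 with ho
  set z := ∑ i, ξ i • toR3 (p i) with hz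
  have hfo : f (toR3 o) < M := by rw [ho, toR3_sub, map_sub, hpf]; linarith
  have hfz : f z = M := by
    rw [hz, map_sum]; simp only [map_smul, smul_eq_mul, hpf]; rw [← Finset.sum_mul, h1, one_mul]
  obtain ⟨v, v3, vP, vf, vD, vz, vl⟩ := plane_descent conv f M o hfo.ne z _ ![p 0, p 1, p 2, o] rfl
    (by intro i hi; fin_cases i <;> simp [hp] at hi ⊢)
    (by intro i hi; fin_cases i <;> simp [hpf] at hi ⊢)
    (by
      convert hind using 1
      simp [tdet, det3, ho]; ring) rfl
    ⟨![ξ 0, ξ 1, ξ 2, 0], by intro i; fin_cases i <;> simp [h0], by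
      simpa [Fin.sum_univ_four, Fin.sum_univ_three] using h1, by
      rw [hz]; simp [Fin.sum_univ_four, Fin.sum_univ_three]⟩
  obtain ⟨η, η0, η1, ηz⟩ := vz
  have η3 := plane_coef vf (by rw [v3]; exact hfo.ne) η1 ηz hfz
  have hS : Setup P C f M (v 0) (v 1 - v 0) (v 2 - v 0) :=
    { conv := conv, comp := comp, sym := sym, cor := cor, fle := fle, fC := fC
      fa := vf 0 (by decide)
      fu := by rw [toR3_sub, map_sub, vf 0 (by decide), vf 1 (by decide), sub_self]
      fw := by rw [toR3_sub, map_sub, vf 0 (by decide), vf 2 (by decide), sub_self]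
      ha := vP 0 (by decide)
      hu := by rw [add_sub_cancel]; exact vP 1 (by decide)
      hw := by rw [add_sub_cancel]; exact vP 2 (by decide)
      ind := by
        obtain ⟨b, c, hbc⟩ := vl (p 0) (hpf 0)
        convert vD using 1
        have : C = o + p 0 := by rw [ho]; abel
        rw [tdet, v3, this, hbc]; simp [det3]; ring
      lat := vl }
  simp only [Fin.sum_univ_four, η3, add_zero, zero_smul] at η1 ηz
  refine hS.facet_cov (η 1) (η 2) τ (η0 1) (η0 2) (by linarith [η0 0]) hτ x ?_
  rw [hx, ηz]
  have : η 0 = 1 - η 1 - η 2 := by linarith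
  rw [this]
  ext k; simp [toR3]; ring


lemma lattice_finite {P : Set (Fin 3 → ℝ)} (hb : Bornology.IsBounded P) : {m : Fin 3 → ℤ | toR3 m ∈ P}.Finite := by
  obtain ⟨R, hR⟩ := hb.subset_closedBall 0
  refine (Set.finite_Icc (fun _ : Fin 3 => -⌈R⌉) (fun _ => ⌈R⌉)).subset ?_
  intro m hm
  have h1 := hR hm
  rw [mem_closedBall_zero_iff] at h1
  have h2 : ∀ k, |(m k : ℝ)| ≤ ⌈R⌉ := fun k =>
    ((norm_le_pi_norm (toR3 m) k).trans h1).trans (Int.le_ceil R)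
  constructor <;> intro k <;> have := abs_le.1 (h2 k)
  · exact_mod_cast this.1
  · exact_mod_cast this.2

lemma inTet_closed (v : Fin 4 → Fin 3 → ℤ) : IsClosed {x | InTet v x} := by
  have : {x | InTet v x} = (fun ξ : Fin 4 → ℝ => ∑ i, ξ i • toR3 (v i)) '' stdSimplex ℝ (Fin 4) := by
    ext x; constructor
    · rintro ⟨ξ, h0, h1, rfl⟩; exact ⟨ξ, ⟨h0, h1⟩, rfl⟩
    · rintro ⟨ξ, ⟨h0, h1⟩, rfl⟩; exact ⟨ξ, h0, h1, rfl⟩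
  rw [this]
  exact ((isCompact_stdSimplex ℝ (Fin 4)).image (by fun_prop)).isClosed

lemma cov_closed {P : Set (Fin 3 → ℝ)} (hb : Bornology.IsBounded P) : IsClosed {x | Cov P x} := by
  have hfin : {v : Fin 4 → Fin 3 → ℤ | (∀ i, toR3 (v i) ∈ P) ∧ (tdet v = 1 ∨ tdet v = -1)}.Finite := by
    refine (Set.Finite.pi (fun _ : Fin 4 => lattice_finite hb)).subset ?_
    intro v hv i _
    exact hv.1 i
  have : {x | Cov P x} = ⋃ v ∈ {v : Fin 4 → Fin 3 → ℤ | (∀ i, toR3 (v i) ∈ P) ∧ (tdet v = 1 ∨ tdet v = -1)}, {x | InTet v x} := by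
    ext x
    simp only [Set.mem_iUnion, exists_prop]
    constructor
    · rintro ⟨v, h1, h2, h3⟩; exact ⟨v, ⟨h1, h2⟩, h3⟩
    · rintro ⟨v, ⟨h1, h2⟩, h3⟩; exact ⟨v, h1, h2, h3⟩
  rw [this]
  exact hfin.isClosed_biUnion fun v _ => inTet_closed v

lemma triple_ne_top (c p q : Fin 3 → ℝ) : affineSpan ℝ {c, p, q} ≠ ⊤ := by
  intro h
  have h2 := (coplanar_triple ℝ c p q).finrank_le_two
  rw [← direction_affineSpan, h, AffineSubspace.direction_top, finrank_top] at h2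
  simp at h2

lemma generic_dense {V : Finset (Fin 3 → ℤ)} (c : Fin 3 → ℝ) :
    Dense {x | ∀ p ∈ V, ∀ q ∈ V, x ∉ affineSpan ℝ {c, toR3 p, toR3 q}} := by
  apply MeasureTheory.Measure.dense_of_ae (μ := MeasureTheory.volume)
  rw [Filter.eventually_all_finset]
  intro p hp
  rw [Filter.eventually_all_finset]
  intro q hq
  rw [MeasureTheory.ae_iff]
  simp only [not_not]
  exact MeasureTheory.Measure.addHaar_affineSubspace _ _ (triple_ne_top _ _ _)

lemma facet_det {C : Fin 3 → ℤ} {f : (Fin 3 → ℝ) →ₗ[ℝ] ℝ} {M : ℝ} (fC : f (toR3 C) < 2 * M)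
    (p : Fin 3 → Fin 3 → ℤ) (hpf : ∀ i, f (toR3 (p i)) = M)
    (hi : AffineIndependent ℝ (fun i => toR3 (p i))) :
    det3 (p 1 - p 0) (p 2 - p 0) (C - 2 • p 0) ≠ 0 := by
  intro h
  have h' : det3 (toR3 (p 1 - p 0)) (toR3 (p 2 - p 0)) (toR3 (C - 2 • p 0)) = 0 := by
    rw [det3_toR3, h]; simp
  rw [← det3_eq, ← Matrix.exists_vecMul_eq_zero_iff] at h'
  obtain ⟨v, hv, hv0⟩ := h'
  have e : v 0 • toR3 (p 1 - p 0) + v 1 • toR3 (p 2 - p 0) + v 2 • toR3 (C - 2 • p 0) = 0 := by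
    rw [← hv0]; ext k; simp [Matrix.vecMul, dotProduct, Fin.sum_univ_three]
  have f3 : f (toR3 (C - 2 • p 0)) = f (toR3 C) - 2 * M := by
    have : C - 2 • p 0 = C - (2:ℤ) • p 0 := by ext k; simp
    rw [this, toR3_sub, toR3_smul]; simp [hpf]
  have hf := congrArg f e
  rw [map_add, map_add, map_smul, map_smul, map_smul, toR3_sub, toR3_sub, map_sub, map_sub, hpf, hpf, hpf, f3] at hf
  simp at hf
  have v2 : v 2 = 0 := by
    rcases hf with h | h
    · exact h
    · linarith
  rw [v2, zero_smul, add_zero] at e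
  rw [affineIndependent_iff] at hi
  have := hi Finset.univ ![- v 0 - v 1, v 0, v 1] (by simp [Fin.sum_univ_three]; ring) (by
    rw [← e]; ext k; simp [Fin.sum_univ_three, toR3]; ring)
  apply hv
  have a1 := this 1 (Finset.mem_univ _)
  have a2 := this 2 (Finset.mem_univ _)
  simp at a1 a2
  ext i; fin_cases i <;> simp [a1, a2, v2]

lemma exit_point {P : Set (Fin 3 → ℝ)} (comp : IsCompact P) {c x : Fin 3 → ℝ} (hx : x ∈ P) (hne : x ≠ c) :
    ∃ t : ℝ, 1 ≤ t ∧ c + t • (x - c) ∈ P ∧ c + t • (x - c) ∉ interior P := by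
  set A := {t : ℝ | c + t • (x - c) ∈ P} with hA
  have hn : 0 < ‖x - c‖ := norm_pos_iff.2 (sub_ne_zero.2 hne)
  have hcl : IsClosed A := comp.isClosed.preimage (by fun_prop)
  obtain ⟨R, hR⟩ := comp.isBounded.subset_closedBall c
  have hbd : Bornology.IsBounded A := by
    refine (Metric.isBounded_closedBall (x := (0:ℝ)) (r := R / ‖x - c‖)).subset ?_
    intro t ht
    have := hR ht
    rw [mem_closedBall_iff_norm, add_sub_cancel_left, norm_smul] at this
    rw [mem_closedBall_zero_iff, le_div_iff₀ hn]; exact this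
  have h1 : (1:ℝ) ∈ A := by simpa [hA] using hx
  obtain ⟨t, htA, htm⟩ := (Metric.isCompact_of_isClosed_isBounded hcl hbd).exists_isGreatest ⟨1, h1⟩
  refine ⟨t, htm h1, htA, fun hint => ?_⟩
  have hc : Continuous fun t : ℝ => c + t • (x - c) := by fun_prop
  have hev : ∀ᶠ s in nhds t, c + s • (x - c) ∈ interior P :=
    hc.continuousAt.eventually (isOpen_interior.mem_nhds hint)
  obtain ⟨s, hs, hst⟩ := ((hev.filter_mono (nhdsWithin_le_nhds (s := Set.Ioi t))).and self_mem_nhdsWithin).exists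
  have hs2 : c + s • (x - c) ∈ P := interior_subset hs
  have := htm (show s ∈ A from hs2)
  exact absurd hst (not_lt.2 this)


lemma caratheodory_facet {V : Finset (Fin 3 → ℤ)} {f : (Fin 3 → ℝ) →ₗ[ℝ] ℝ} {M : ℝ} (hf0 : f ≠ 0)
    (fle : ∀ p ∈ V, f (toR3 p) ≤ M) {z : Fin 3 → ℝ} (hz : z ∈ convexHull ℝ (toR3 '' (V : Set (Fin 3 → ℤ))))
    (hfz : f z = M) (hgen : ∀ p ∈ V, ∀ q ∈ V, z ∉ affineSpan ℝ {toR3 p, toR3 q}) :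
    ∃ (p : Fin 3 → Fin 3 → ℤ) (ξ : Fin 3 → ℝ), (∀ i, p i ∈ V) ∧ (∀ i, f (toR3 (p i)) = M) ∧
      AffineIndependent ℝ (fun i => toR3 (p i)) ∧ (∀ i, 0 ≤ ξ i) ∧ ∑ i, ξ i = 1 ∧ z = ∑ i, ξ i • toR3 (p i) := by
  obtain ⟨ι, hι, y, w, hyr, hai, hw, hw1, hwz⟩ := eq_pos_convex_span_of_mem_convexHull hz
  have hy : ∀ i, ∃ p ∈ V, toR3 p = y i := fun i => hyr ⟨i, rfl⟩
  choose p hpV hpy using hy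
  have hfM : ∀ i, f (y i) = M := by
    have h0 : ∑ i, w i * (M - f (y i)) = 0 := by
      simp only [mul_sub, Finset.sum_sub_distrib, ← Finset.sum_mul, hw1]
      rw [← hfz, ← hwz, map_sum]; simp
    rw [Finset.sum_eq_zero_iff_of_nonneg] at h0
    · intro i
      have := h0 i (Finset.mem_univ _)
      rcases mul_eq_zero.1 this with h | h
      · exact absurd h (hw i).ne'
      · linarith
    · intro i _
      have := fle _ (hpV i); rw [hpy] at this
      exact mul_nonneg (hw i).le (by linarith)
  have hne : Nonempty ι := by
    by_contra h
    rw [not_nonempty_iff] at h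
    simp at hw1
  have hle3 : Fintype.card ι ≤ 3 := by
    have h1 := hai.card_le_finrank_succ
    have h2 : vectorSpan ℝ (Set.range y) ≤ LinearMap.ker f := by
      rw [vectorSpan_def, Submodule.span_le]
      rintro _ ⟨_, ⟨i, rfl⟩, _, ⟨j, rfl⟩, rfl⟩
      simp [hfM]
    have h3 := Submodule.finrank_mono h2
    have h4 : Module.finrank ℝ (LinearMap.ker f) < 3 := by
      have := Submodule.finrank_lt (s := LinearMap.ker f) (by rwa [Ne, LinearMap.ker_eq_top])
      simpa using this
    omega
  have hge3 : 3 ≤ Fintype.card ι := by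
    by_contra hlt
    have hmem : z ∈ affineSpan ℝ (Set.range y) := by
      have : z ∈ convexHull ℝ (Set.range y) := by
        rw [← hwz]
        exact (convex_convexHull ℝ _).sum_mem (fun i _ => (hw i).le) hw1 (fun i _ => subset_convexHull ℝ _ ⟨i, rfl⟩)
      exact convexHull_subset_affineSpan _ this
    obtain ⟨i, j, hij⟩ : ∃ i j : ι, ∀ k, k = i ∨ k = j := by
      obtain ⟨i⟩ := hne
      by_cases hall : ∀ k, k = i
      · exact ⟨i, i, fun k => Or.inl (hall k)⟩
      push Not at hall
      obtain ⟨j, hj⟩ := hall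
      refine ⟨i, j, fun k => ?_⟩
      by_contra hk
      push Not at hk
      apply hlt
      classical
      have : ({i, j, k} : Finset ι).card = 3 := by
        rw [Finset.card_eq_three]; exact ⟨i, j, k, hj.symm, hk.1.symm, hk.2.symm, rfl⟩
      rw [← this]; exact Finset.card_le_univ _
    apply hgen _ (hpV i) _ (hpV j)
    rw [hpy, hpy]
    refine affineSpan_mono ℝ ?_ hmem
    rintro _ ⟨k, rfl⟩
    rcases hij k with rfl | rfl <;> simp
  have hcard : Fintype.card ι = 3 := le_antisymm hle3 hge3
  let e : Fin 3 ≃ ι := (Fintype.equivFinOfCardEq hcard).symm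
  refine ⟨fun i => p (e i), fun i => w (e i), fun i => hpV _, fun i => by rw [hpy, hfM], ?_, fun i => (hw _).le, ?_, ?_⟩
  · simp only [hpy]
    exact hai.comp_embedding e.toEmbedding
  · rw [← hw1]; exact e.sum_comp w
  · rw [← hwz]; simp only [hpy]; exact (e.sum_comp (fun i => w i • y i)).symm

theorem main_aux
    (V : Finset (Fin 3 → ℤ)) (P : Set (Fin 3 → ℝ))
    (hP : P = convexHull ℝ (toR3 '' ↑V))
    (hdim : affineSpan ℝ P = ⊤)
    (hsmooth : IsSmooth P)
    (hsym : ∃ c : Fin 3 → ℝ, ∀ x, x ∈ P ↔ (2:ℝ) • c - x ∈ P) :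
    HasUnimodularCover P := by
  obtain ⟨c, hc⟩ := hsym
  have conv : Convex ℝ P := hP ▸ convex_convexHull ℝ _
  have comp : IsCompact P := by
    rw [hP]; exact (V.finite_toSet.image toR3).isCompact_convexHull (𝕜 := ℝ)
  have hintne : (interior P).Nonempty := conv.interior_nonempty_iff_affineSpan_eq_top.2 hdim
  have hPne : P.Nonempty := hintne.mono interior_subset
  have hne : ∀ v, ∃ x ∈ toR3 '' (V : Set (Fin 3 → ℤ)), x ≠ v := by
    intro v
    by_contra hcon
    push Not at hcon
    have : P ⊆ {v} := by
      rw [hP]; exact convexHull_min (fun x hx => hcon x hx) (convex_singleton v)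
    have h2 := interior_mono this
    rw [interior_singleton] at h2
    obtain ⟨y, hy⟩ := hintne
    exact h2 hy
  have cor0 := fun v hv => corner_exists hP hne hsmooth (v := v) hv
  have cor : ∀ v ∈ Set.extremePoints ℝ P, ∃ v', toR3 v' = v ∧ ∃ d, Corner P v' d := fun v hv => by
    obtain ⟨v', -, h1, h2⟩ := cor0 v hv
    exact ⟨v', h1, h2⟩
  obtain ⟨C, hC⟩ : ∃ C : Fin 3 → ℤ, toR3 C = (2:ℝ) • c := by
    obtain ⟨v, hv⟩ := comp.extremePoints_nonempty hPne
    have hv2 : (2:ℝ) • c - v ∈ Set.extremePoints ℝ P := by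
      refine ⟨(hc v).1 hv.1, ?_⟩
      rintro x hx y hy ⟨s, t, hs, ht, hst, e⟩
      have := hv.2 ((hc x).1 hx) ((hc y).1 hy) ⟨s, t, hs, ht, hst, by
        have : v = (2:ℝ) • c - (s • x + t • y) := by rw [e]; abel
        rw [this]
        have ht' : t = 1 - s := by linarith
        rw [ht']; ext k; simp; ring⟩
      rw [← this]; abel
    obtain ⟨v', h1, -⟩ := cor v hv
    obtain ⟨v'', h2, -⟩ := cor _ hv2
    exact ⟨v' + v'', by rw [toR3_add, h1, h2]; abel⟩
  have hcC : (1/2:ℝ) • toR3 C = c := by rw [hC, smul_smul]; norm_num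
  have sym : ∀ x ∈ P, toR3 C - x ∈ P := fun x hx => by rw [hC]; exact (hc x).1 hx
  have hcint : c ∈ interior P := by
    obtain ⟨y, hy⟩ := hintne
    have := conv.combo_interior_self_mem_interior hy ((hc y).1 (interior_subset hy)) (a := 1/2) (b := 1/2)
      (by norm_num) (by norm_num) (by norm_num)
    convert this using 1
    ext k; simp; ring
  have hclos : P ⊆ closure (interior P) := by
    rw [conv.closure_interior_eq_closure_of_nonempty_interior hintne]; exact subset_closure
  refine cover_of_cov conv ?_
  suffices hgen : interior P ∩ {x | ∀ p ∈ V, ∀ q ∈ V, x ∉ affineSpan ℝ {c, toR3 p, toR3 q}} ⊆ {x | Cov P x} by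
    have h1 : interior P ⊆ {x | Cov P x} :=
      ((generic_dense (V := V) c).open_subset_closure_inter isOpen_interior).trans
        (closure_minimal hgen (cov_closed comp.isBounded))
    intro x hx
    exact closure_minimal h1 (cov_closed comp.isBounded) (hclos hx)
  rintro x ⟨hxi, hxg⟩
  obtain ⟨_, ⟨p0, hp0, rfl⟩, -⟩ := hne 0
  have hxc : x ≠ c := by
    rintro rfl
    exact hxg p0 hp0 p0 hp0 (subset_affineSpan ℝ _ (by simp))
  obtain ⟨t, ht, hzP, hzi⟩ := exit_point comp (interior_subset hxi) hxc
  have ht0 : 0 < t := by linarith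
  obtain ⟨z, hz⟩ : ∃ z, z = c + t • (x - c) := ⟨_, rfl⟩
  rw [← hz] at hzP hzi
  have hxz : x = (1 - 1 / t) • c + (1 / t) • z := by
    rw [hz]; ext k; simp; field_simp; ring
  obtain ⟨F, hF⟩ := geometric_hahn_banach_open_point conv.interior isOpen_interior hzi
  have fle : ∀ y ∈ P, F y ≤ F z := by
    intro y hy
    have : closure (interior P) ⊆ {y | F y ≤ F z} :=
      closure_minimal (fun y hy => (hF y hy).le) (isClosed_le F.continuous continuous_const)
    exact this (hclos hy)
  have hVP : ∀ p ∈ V, toR3 p ∈ P := fun p hp => by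
    rw [hP]; exact subset_convexHull ℝ _ ⟨p, hp, rfl⟩
  have hcF := hF c hcint
  obtain ⟨p, ξ, pV, pf, pai, ξ0, ξ1, ξz⟩ := caratheodory_facet (V := V) (f := F.toLinearMap) (M := F z) (z := z)
    (by
      intro h0
      have h1 : F c = 0 := by have := congrArg (fun g => g c) h0; simpa using this
      have h2 : F z = 0 := by have := congrArg (fun g => g z) h0; simpa using this
      rw [h1, h2] at hcF; exact lt_irrefl _ hcF)
    (fun p hp => fle _ (hVP p hp)) (hP ▸ hzP) rfl (by
      intro p hp q hq hmem
      apply hxg p hp q hq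
      have hz' : z ∈ affineSpan ℝ {c, toR3 p, toR3 q} :=
        affineSpan_mono ℝ (Set.subset_insert _ _) hmem
      have hc' : c ∈ affineSpan ℝ {c, toR3 p, toR3 q} := subset_affineSpan ℝ _ (by simp)
      have := AffineMap.lineMap_mem (1 / t) hc' hz'
      rw [AffineMap.lineMap_apply_module] at this
      rw [hxz]; exact this)
  have fC : F.toLinearMap (toR3 C) < 2 * F z := by
    have : F.toLinearMap (toR3 C) = 2 * F c := by rw [hC]; simp
    rw [this]; linarith
  refine facet_final conv comp sym cor fle fC p (fun i => hVP _ (pV i)) pf (facet_det fC p pf pai) ξ ξ0 ξ1 (1 / t)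
    ⟨by positivity, by rw [div_le_one ht0]; exact ht⟩ x ?_
  rw [hcC, ← ξz]; exact hxz

/-- Every smooth centrally symmetric lattice 3-polytope has a unimodular cover. -/
theorem smooth_centrally_symmetric_has_unimodular_cover
    (V : Finset (Fin 3 → ℤ)) (P : Set (Fin 3 → ℝ))
    (hP : P = convexHull ℝ (toR3 '' ↑V))
    (hdim : affineSpan ℝ P = ⊤)
    (hsmooth : IsSmooth P)
    (hsym : ∃ c : Fin 3 → ℝ, ∀ x, x ∈ P ↔ (2:ℝ) • c - x ∈ P) :
    HasUnimodularCover P := by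
  exact main_aux V P hP hdim hsmooth hsym
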